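/- The set of all quotients p q⁻¹ of Hurwitz primes p, q is dense in the quaternions. -/

import Mathlib

noncomputable def qNorm (a : Quaternion ℝ) : ℝ :=
  a.re ^ 2 + a.imI ^ 2 + a.imJ ^ 2 + a.imK ^ 2

def IsHurwitz (a : Quaternion ℝ) : Prop :=
  (∃ x₁ x₂ x₃ x₄ : ℤ, a = ⟨(x₁ : ℝ), x₂, x₃, x₄⟩) ∨
  (∃ x₁ x₂ x₃ x₄ : ℤ, a = ⟨(x₁ : ℝ) + 1/2, (x₂ : ℝ) + 1/2, (x₃ : ℝ) + 1/2, (x₄ : ℝ) + 1/2⟩)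

def IsHurwitzPrime (p : Quaternion ℝ) : Prop :=
  IsHurwitz p ∧ ∃ r : ℕ, r.Prime ∧ qNorm p = r

open Filter Topology MeasureTheory Set

/-- The Fejér kernel. -/
noncomputable def fejer (T v : ℝ) : ℝ := T * Real.sinc (T * v / 2) ^ 2

lemma fejer_nonneg {T : ℝ} (hT : 0 < T) (v : ℝ) : 0 ≤ fejer T v := by
  unfold fejer; positivity

lemma continuous_fejer (T : ℝ) : Continuous (fejer T) := by
  unfold fejer
  have := Real.continuous_sinc
  fun_prop

lemma fejer_mul_sq {T : ℝ} (hT : 0 < T) (v : ℝ) :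
    fejer T v * (T * v ^ 2) = 2 * (1 - Real.cos (T * v)) := by
  rcases eq_or_ne v 0 with rfl | hv
  · simp
  · have h : T * v / 2 ≠ 0 := by positivity
    have hc : Real.cos (T * v) = 1 - 2 * Real.sin (T * v / 2) ^ 2 := by
      have := Real.cos_two_mul (T * v / 2)
      have h2 := Real.sin_sq_add_cos_sq (T * v / 2)
      rw [show 2 * (T * v / 2) = T * v by ring] at this
      linarith
    rw [fejer, Real.sinc_of_ne_zero h, hc]
    field_simp
    ring

lemma fejer_mul_one_add_sq_le {T : ℝ} (hT : 0 < T) (v : ℝ) :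
    fejer T v * (1 + v ^ 2) ≤ T + 4 / T := by
  have h1 : fejer T v ≤ T := by
    unfold fejer
    have : Real.sinc (T * v / 2) ^ 2 ≤ 1 := by
      rw [sq_le_one_iff_abs_le_one]
      exact abs_le.2 ⟨Real.neg_one_le_sinc _, Real.sinc_le_one _⟩
    nlinarith
  have h2 : fejer T v * v ^ 2 ≤ 4 / T := by
    rw [le_div_iff₀ hT]
    have := fejer_mul_sq hT v
    have := Real.neg_one_le_cos (T * v)
    nlinarith
  linarith

lemma integrable_fejer {T : ℝ} (hT : 0 < T) : Integrable (fejer T) := by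
  refine (integrable_inv_one_add_sq.const_mul (T + 4 / T)).mono'
    (continuous_fejer T).aestronglyMeasurable (ae_of_all _ fun v => ?_)
  rw [Real.norm_of_nonneg (fejer_nonneg hT v), ← div_eq_mul_inv, le_div_iff₀ (by positivity)]
  exact fejer_mul_one_add_sq_le hT v

lemma half_le_fejer {T v : ℝ} (hT : 0 < T) (hv : 0 ≤ v) (hvT : T * v ≤ 1) :
    T / 2 ≤ fejer T v := by
  rcases hv.eq_or_lt with rfl | hv
  · simp [fejer]; linarith
  have hx : 0 < T * v / 2 := by positivity
  have h1 := Real.sin_gt_sub_cube hx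
  have h2 : 15 / 16 ≤ Real.sinc (T * v / 2) := by
    rw [Real.sinc_of_ne_zero hx.ne', le_div_iff₀ hx]
    have : (T * v / 2) ^ 2 ≤ 1 / 4 := by nlinarith
    nlinarith
  unfold fejer
  have : (1 : ℝ) / 2 ≤ Real.sinc (T * v / 2) ^ 2 := by nlinarith
  nlinarith

/-- Away from the origin a narrow Fejér kernel is dominated by two wide ones. -/
lemma exists_fejer_le {δ : ℝ} (hδ : 0 < δ) : ∃ C : ℝ, 0 < C ∧ ∀ T : ℝ, 0 < T → ∀ v : ℝ,
    δ ≤ |v| → fejer T v ≤ C / T * (fejer 1 v + fejer 1 (v + 1)) := by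
  have hcos : Real.cos (1 / 2) < 1 := by
    have := Real.cos_lt_cos_of_nonneg_of_le_pi le_rfl
      (by linarith [Real.pi_gt_three]) (show (0 : ℝ) < 1 / 2 by norm_num)
    simpa using this
  have hcos0 : 0 < Real.cos (1 / 2) :=
    Real.cos_pos_of_mem_Ioo ⟨by linarith [Real.pi_gt_three], by linarith [Real.pi_gt_three]⟩
  have hc : 0 < 1 - Real.cos (1 / 2) := by linarith
  refine ⟨(1 + 1 / δ) ^ 2 / (1 - Real.cos (1 / 2)), by positivity, fun T hT v hv => ?_⟩
  have hv0 : v ≠ 0 := by rintro rfl; simp at hv; linarith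
  have h1 := fejer_mul_sq one_pos v
  have h2 := fejer_mul_sq one_pos (v + 1)
  have h3 : fejer T v * (T * v ^ 2) ≤ 4 := by
    rw [fejer_mul_sq hT]; linarith [Real.neg_one_le_cos (T * v)]
  have h4 : (v + 1) ^ 2 ≤ (1 + 1 / δ) ^ 2 * v ^ 2 := by
    rw [← mul_pow, sq_le_sq, abs_mul, abs_of_pos (a := 1 + 1 / δ) (by positivity)]
    have : 1 ≤ 1 / δ * |v| := by
      rw [one_div_mul_eq_div, le_div_iff₀ hδ]; linarith
    calc |v + 1| ≤ |v| + |1| := abs_add_le _ _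
      _ ≤ (1 + 1 / δ) * |v| := by rw [abs_one]; linarith
  have h5 : v ^ 2 ≤ (1 + 1 / δ) ^ 2 * v ^ 2 := by
    have : 1 ≤ (1 + 1 / δ) ^ 2 := one_le_pow₀ (by linarith [one_div_pos.2 hδ])
    nlinarith [sq_nonneg v]
  have h6 : Real.cos v + Real.cos (v + 1) ≤ 2 * Real.cos (1 / 2) := by
    have := Real.cos_add_cos v (v + 1)
    rw [this, show (v - (v + 1)) / 2 = -(1 / 2) by ring, Real.cos_neg]
    nlinarith [Real.cos_le_one ((v + (v + 1)) / 2)]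
  rw [one_mul] at h1 h2
  rw [one_mul] at h1 h2
  have h7 : 4 * (1 - Real.cos (1 / 2)) ≤
      (1 + 1 / δ) ^ 2 * v ^ 2 * (fejer 1 v + fejer 1 (v + 1)) := by
    nlinarith [mul_le_mul_of_nonneg_left h5 (fejer_nonneg one_pos v),
      mul_le_mul_of_nonneg_left h4 (fejer_nonneg one_pos (v + 1))]
  rw [div_div, div_mul_eq_mul_div, le_div_iff₀ (by positivity)]
  have hv2 : 0 < v ^ 2 := by positivity
  refine le_of_mul_le_mul_right ?_ hv2
  nlinarith [mul_le_mul_of_nonneg_right h3 hc.le]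

lemma integral_fejer_eq {T : ℝ} (hT : 0 < T) (v : ℝ) :
    ∫ u in (-T)..T, ((1 - |u| / T : ℝ) : ℂ) * Complex.exp (u * v * Complex.I) = fejer T v := by
  have key : ∫ u in (0)..T, (1 - u / T) * (2 * Real.cos (u * v)) = fejer T v := by
    rcases eq_or_ne v 0 with rfl | hv
    · have : ∀ u ∈ uIcc 0 T, HasDerivAt (fun u : ℝ => 2 * u - u ^ 2 / T)
          ((1 - u / T) * (2 * Real.cos (u * 0))) u := by
        intro u _
        have h := ((hasDerivAt_id u).const_mul 2).sub (((hasDerivAt_id u).pow 2).div_const T)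
        convert! h using 1
        simp
        ring
      rw [intervalIntegral.integral_eq_sub_of_hasDerivAt this
        (Continuous.intervalIntegrable (by fun_prop) _ _)]
      simp [fejer]
      field_simp
      ring
    · have : ∀ u ∈ uIcc 0 T, HasDerivAt (fun u : ℝ => 2 * ((1 - u / T) * (Real.sin (u * v) / v)
          - Real.cos (u * v) / (T * v ^ 2))) ((1 - u / T) * (2 * Real.cos (u * v))) u := by
        intro u _
        have h0 := (hasDerivAt_id u).mul_const v
        have h1 := ((hasDerivAt_id u).div_const T).const_sub 1
        have h := ((h1.mul (h0.sin.div_const v)).sub (h0.cos.div_const (T * v ^ 2))).const_mul 2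
        convert! h using 1
        simp
        field_simp
        ring
      rw [intervalIntegral.integral_eq_sub_of_hasDerivAt this
        (Continuous.intervalIntegrable (by fun_prop) _ _)]
      have h := fejer_mul_sq hT v
      have : fejer T v = 2 * (1 - Real.cos (T * v)) / (T * v ^ 2) := by
        rw [eq_div_iff (by positivity), h]
      rw [this]
      simp
      field_simp
      ring
  have hi : ∀ a b, IntervalIntegrable (fun u : ℝ => ((1 - |u| / T : ℝ) : ℂ) *
      Complex.exp (u * v * Complex.I)) volume a b := fun a b =>
    Continuous.intervalIntegrable (by fun_prop) _ _
  rw [← intervalIntegral.integral_add_adjacent_intervals (hi (-T) 0) (hi 0 T)]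
  have h1 := intervalIntegral.integral_comp_neg (a := 0) (b := T) (fun u : ℝ =>
    ((1 - |u| / T : ℝ) : ℂ) * Complex.exp (u * v * Complex.I))
  rw [neg_zero] at h1
  rw [← h1, ← intervalIntegral.integral_add (Continuous.intervalIntegrable (by fun_prop) _ _)
    (hi 0 T), ← key, ← intervalIntegral.integral_ofReal]
  refine intervalIntegral.integral_congr fun u hu => ?_
  rw [uIcc_of_le hT.le] at hu
  simp only [abs_neg, abs_of_nonneg hu.1]
  push_cast
  rw [Complex.cos, ← mul_add]
  ring_nf

open ArithmeticFunction in
/-- The Dirichlet series of the von Mangoldt function with its pole at `1` removed. -/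
noncomputable def vonMangoldtAux (s : ℂ) : ℂ :=
  vonMangoldt.LFunctionResidueClassAux (1 : ZMod 1) s

lemma LSeries_vonMangoldt_eq_aux {s : ℂ} (hs : 1 < s.re) :
    LSeries (fun n => (ArithmeticFunction.vonMangoldt n : ℂ)) s =
      1 / (s - 1) + vonMangoldtAux s := by
  have h := ArithmeticFunction.vonMangoldt.eqOn_LFunctionResidueClassAux
    (a := (1 : ZMod 1)) isUnit_one hs
  have hres : (fun n : ℕ => (ArithmeticFunction.vonMangoldt.residueClass (1 : ZMod 1) n : ℂ)) =
      fun n => (ArithmeticFunction.vonMangoldt n : ℂ) := by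
    funext n
    rw [ArithmeticFunction.vonMangoldt.residueClass, Set.indicator_of_mem]
    exact Subsingleton.elim _ _
  simp only [hres] at h
  rw [vonMangoldtAux, h]
  simp

/-- The boundary values `vonMangoldtAux (1 + ε - iu)`, extended to all real `ε`. -/
noncomputable def vonMangoldtBdry (ε u : ℝ) : ℂ :=
  vonMangoldtAux (1 + (max ε 0 : ℝ) - u * Complex.I)

lemma continuous_vonMangoldtBdry :
    Continuous fun p : ℝ × ℝ => vonMangoldtBdry p.1 p.2 := by
  have h := ArithmeticFunction.vonMangoldt.continuousOn_LFunctionResidueClassAux (1 : ZMod 1)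
  refine h.comp_continuous
    (f := fun p : ℝ × ℝ => 1 + ((max p.1 0 : ℝ) : ℂ) - p.2 * Complex.I) (by fun_prop) fun p => ?_
  simp

/-- The error term in the smoothed count of prime powers near `exp y`. -/
noncomputable def fejerError (T ε y : ℝ) : ℂ :=
  ∫ u in (-T)..T, ((1 - |u| / T : ℝ) : ℂ) * Complex.exp (-(u * y) * Complex.I) *
    vonMangoldtBdry ε u

lemma continuous_fejerError (T y : ℝ) : Continuous fun ε => fejerError T ε y := by
  refine intervalIntegral.continuous_parametric_intervalIntegral_of_continuous' ?_ _ _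
  have := continuous_vonMangoldtBdry
  simp only [Function.uncurry_def]
  fun_prop

lemma tendsto_fejerError (T : ℝ) (hT : 0 < T) :
    Tendsto (fun y => fejerError T 0 y) atTop (𝓝 0) := by
  have h := Real.tendsto_integral_exp_smul_cocompact
    ((Ioc (-T) T).indicator fun u : ℝ => ((1 - |u| / T : ℝ) : ℂ) * vonMangoldtBdry 0 u)
  have h2 : Tendsto (fun y : ℝ => y / (2 * Real.pi)) atTop (cocompact ℝ) :=
    (tendsto_id.atTop_div_const (by positivity)).mono_right atTop_le_cocompact
  refine (h.comp h2).congr fun y => ?_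
  rw [fejerError, intervalIntegral.integral_of_le (by linarith), ← integral_indicator
    measurableSet_Ioc]
  refine integral_congr_ae (ae_of_all _ fun u => ?_)
  by_cases hu : u ∈ Ioc (-T) T
  · simp only [Set.indicator_of_mem hu, Circle.smul_def, Real.fourierChar_apply, smul_eq_mul]
    have : ((2 * Real.pi * -(u * (y / (2 * Real.pi))) : ℝ) : ℂ) = -(u * y) := by
      push_cast
      have : (Real.pi : ℂ) ≠ 0 := by exact_mod_cast Real.pi_ne_zero
      field_simp
    rw [this]; ring
  · simp [Set.indicator_of_notMem hu]

lemma norm_fejerWeight_le {T u : ℝ} (hT : 0 < T) (hu : u ∈ uIoc (-T) T) :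
    ‖((1 - |u| / T : ℝ) : ℂ)‖ ≤ 1 := by
  rw [uIoc_of_le (by linarith)] at hu
  have h1 : |u| / T ≤ 1 := (div_le_one hT).2 (abs_le.2 ⟨hu.1.le, hu.2⟩)
  have h2 : 0 ≤ |u| / T := by positivity
  rw [Complex.norm_real, Real.norm_of_nonneg (by linarith)]
  linarith

lemma norm_exp_mul_I_real (x : ℝ) (z : ℂ) (h : z = x * Complex.I) : ‖Complex.exp z‖ = 1 := by
  rw [h, Complex.norm_exp_ofReal_mul_I]

lemma integral_fejer_exp {T ε : ℝ} (hT : 0 < T) (hε : 0 < ε) (y : ℝ) :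
    ∫ u in (-T)..T, ((1 - |u| / T : ℝ) : ℂ) * Complex.exp (-(u * y) * Complex.I) *
      (1 / (ε - u * Complex.I)) =
    ((∫ v in Ioi (0 : ℝ), Real.exp (-ε * v) * fejer T (v - y) : ℝ) : ℂ) := by
  have hinner : ∀ u : ℝ, ((1 - |u| / T : ℝ) : ℂ) * Complex.exp (-(u * y) * Complex.I) *
      (1 / (ε - u * Complex.I)) = ∫ v in Ioi (0 : ℝ), ((1 - |u| / T : ℝ) : ℂ) *
        (Complex.exp (-(u * y) * Complex.I) * Complex.exp ((-ε + u * Complex.I) * v)) := by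
    intro u
    rw [integral_const_mul, integral_const_mul, integral_exp_mul_complex_Ioi (by simpa using hε)]
    simp only [Complex.ofReal_zero, mul_zero, Complex.exp_zero]
    rw [mul_assoc, show (-ε + u * Complex.I : ℂ) = -(ε - u * Complex.I) by ring, neg_div_neg_eq]
  simp_rw [hinner]
  rw [intervalIntegral.integral_of_le (by linarith), integral_integral_swap, ← integral_complex_ofReal]
  · refine integral_congr_ae (ae_of_all _ fun v => ?_)
    simp only
    rw [Complex.ofReal_mul, ← integral_fejer_eq hT, intervalIntegral.integral_of_le (by linarith),
      ← integral_const_mul]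
    refine integral_congr_ae (ae_of_all _ fun u => ?_)
    simp only
    rw [← Complex.exp_add, Complex.ofReal_exp, mul_left_comm, ← Complex.exp_add]
    congr 2
    push_cast
    ring
  · have hb : Integrable (fun z : ℝ × ℝ => (1 : ℝ) * Real.exp (-ε * z.2))
        ((volume.restrict (Ioc (-T) T)).prod (volume.restrict (Ioi 0))) :=
      Integrable.mul_prod (f := fun _ : ℝ => (1 : ℝ)) (g := fun v => Real.exp (-ε * v))
        (integrable_const 1) (exp_neg_integrableOn_Ioi 0 hε)
    refine hb.mono' (Continuous.aestronglyMeasurable (by fun_prop)) ?_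
    rw [Measure.prod_restrict]
    filter_upwards [ae_restrict_mem (measurableSet_Ioc.prod measurableSet_Ioi)] with z hz
    rw [Function.uncurry_def, norm_mul, norm_mul]
    have h1 := norm_fejerWeight_le hT (u := z.1) (by rw [uIoc_of_le (by linarith)]; exact hz.1)
    have h2 : ‖Complex.exp (-(z.1 * y) * Complex.I)‖ = 1 :=
      norm_exp_mul_I_real (-(z.1 * y)) _ (by push_cast; ring)
    have h3 : ‖Complex.exp ((-ε + z.1 * Complex.I) * z.2)‖ = Real.exp (-ε * z.2) := by
      rw [Complex.norm_exp]; simp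
    rw [h2, h3, one_mul]
    exact mul_le_of_le_one_left (Real.exp_pos _).le h1

lemma hasSum_vonMangoldt_fejer {T ε : ℝ} (hT : 0 < T) (hε : 0 < ε) (y : ℝ) :
    HasSum (fun n : ℕ => ArithmeticFunction.vonMangoldt n / (n : ℝ) ^ (1 + ε) *
        fejer T (Real.log n - y))
      ((∫ v in Ioi (0 : ℝ), Real.exp (-ε * v) * fejer T (v - y)) + (fejerError T ε y).re) := by
  set Λ := ArithmeticFunction.vonMangoldt
  have hterm : ∀ (n : ℕ) (u : ℝ), LSeries.term (fun n => (Λ n : ℂ)) (1 + ε - u * Complex.I) n =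
      ((Λ n / (n : ℝ) ^ (1 + ε) : ℝ) : ℂ) * Complex.exp (u * Real.log n * Complex.I) := by
    intro n u
    rcases Nat.eq_zero_or_pos n with rfl | hn
    · simp [Λ]
    · have hn' : (n : ℂ) ≠ 0 := by exact_mod_cast hn.ne'
      rw [LSeries.term_of_ne_zero hn.ne', sub_eq_add_neg, Complex.cpow_add _ _ hn']
      push_cast
      rw [Complex.ofReal_cpow (by positivity)]
      push_cast
      rw [Complex.cpow_def_of_ne_zero hn' (-(u * Complex.I)), ← Complex.natCast_log, ← div_div,
        div_eq_mul_inv _ (Complex.exp _), ← Complex.exp_neg]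
      congr 2
      ring
  have hsum : Summable fun n : ℕ => Λ n / (n : ℝ) ^ (1 + ε) := by
    have h := (ArithmeticFunction.LSeriesSummable_vonMangoldt (s := 1 + ε - (0 : ℝ) * Complex.I)
      (by simpa using hε))
    rw [LSeriesSummable, show (LSeries.term (fun n => (Λ n : ℂ)) (1 + ε - (0 : ℝ) * Complex.I)) =
      fun n : ℕ => ((Λ n / (n : ℝ) ^ (1 + ε) : ℝ) : ℂ) by funext n; rw [hterm]; simp] at h
    exact_mod_cast h
  have hnn : ∀ n : ℕ, 0 ≤ Λ n / (n : ℝ) ^ (1 + ε) := fun n =>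
    div_nonneg ArithmeticFunction.vonMangoldt_nonneg (by positivity)
  have hs : ∀ u : ℝ, 1 < (1 + ε - u * Complex.I : ℂ).re := fun u => by simpa using hε
  have key := intervalIntegral.hasSum_integral_of_dominated_convergence (a := -T) (b := T)
    (μ := volume) (F := fun (n : ℕ) (u : ℝ) => ((1 - |u| / T : ℝ) : ℂ) *
      Complex.exp (-(u * y) * Complex.I) * LSeries.term (fun n => (Λ n : ℂ))
        (1 + ε - u * Complex.I) n)
    (f := fun u : ℝ => ((1 - |u| / T : ℝ) : ℂ) * Complex.exp (-(u * y) * Complex.I) *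
      LSeries (fun n => (Λ n : ℂ)) (1 + ε - u * Complex.I))
    (fun n _ => Λ n / (n : ℝ) ^ (1 + ε)) ?_ ?_ ?_ ?_ ?_
  · have hL : ∀ n : ℕ, ∫ u in (-T)..T, ((1 - |u| / T : ℝ) : ℂ) *
        Complex.exp (-(u * y) * Complex.I) * LSeries.term (fun n => (Λ n : ℂ))
        (1 + ε - u * Complex.I) n =
        ((Λ n / (n : ℝ) ^ (1 + ε) * fejer T (Real.log n - y) : ℝ) : ℂ) := by
      intro n
      rw [Complex.ofReal_mul, ← integral_fejer_eq hT, ← intervalIntegral.integral_const_mul]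
      refine intervalIntegral.integral_congr fun u _ => ?_
      simp only [hterm]
      rw [mul_left_comm, mul_assoc, ← Complex.exp_add]
      congr 3
      push_cast
      ring
    have hR : ∫ u in (-T)..T, ((1 - |u| / T : ℝ) : ℂ) *
        Complex.exp (-(u * y) * Complex.I) * LSeries (fun n => (Λ n : ℂ))
        (1 + ε - u * Complex.I) =
        ((∫ v in Ioi (0 : ℝ), Real.exp (-ε * v) * fejer T (v - y) : ℝ) : ℂ)
          + fejerError T ε y := by
      have hne : ∀ u : ℝ, (ε - u * Complex.I : ℂ) ≠ 0 := by
        intro u hu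
        have := congrArg Complex.re hu
        simp at this
        exact hε.ne' this
      have hcb := continuous_vonMangoldtBdry
      have hcb' : Continuous fun u : ℝ => vonMangoldtBdry ε u := by fun_prop
      rw [← integral_fejer_exp hT hε, fejerError, ← intervalIntegral.integral_add]
      · refine intervalIntegral.integral_congr fun u _ => ?_
        rw [LSeries_vonMangoldt_eq_aux (hs u), vonMangoldtBdry, max_eq_left hε.le]
        ring
      · refine Continuous.intervalIntegrable ?_ _ _
        have : Continuous fun u : ℝ => 1 / (ε - u * Complex.I : ℂ) :=
          continuous_const.div (by fun_prop) hne
        fun_prop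
      · exact Continuous.intervalIntegrable (by fun_prop) _ _
    simp_rw [hL] at key
    rw [hR] at key
    have := Complex.hasSum_re key
    simpa using this
  · intro n
    refine Continuous.aestronglyMeasurable ?_
    simp_rw [hterm]
    fun_prop
  · intro n
    refine ae_of_all _ fun u hu => ?_
    have hn : ‖((Λ n / (n : ℝ) ^ (1 + ε) : ℝ) : ℂ)‖ = Λ n / (n : ℝ) ^ (1 + ε) := by
      rw [Complex.norm_real, Real.norm_of_nonneg (hnn n)]
    rw [hterm, norm_mul, norm_mul, norm_mul, norm_exp_mul_I_real (-(u * y)) _ (by push_cast; ring),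
      norm_exp_mul_I_real (u * Real.log n) _ (by push_cast; ring), hn, mul_one, mul_one]
    exact mul_le_of_le_one_left (hnn n) (norm_fejerWeight_le hT hu)
  · exact ae_of_all _ fun _ _ => hsum
  · exact intervalIntegrable_const
  · refine ae_of_all _ fun u _ => ?_
    exact HasSum.mul_left _ (ArithmeticFunction.LSeriesSummable_vonMangoldt (hs u)).LSeriesHasSum

lemma tendsto_vonMangoldt_div_rpow (n : ℕ) : Tendsto
    (fun ε : ℝ => ArithmeticFunction.vonMangoldt n / (n : ℝ) ^ (1 + ε)) (𝓝[>] 0)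
    (𝓝 (ArithmeticFunction.vonMangoldt n / n)) := by
  rcases Nat.eq_zero_or_pos n with rfl | hn
  · simp
  have hn' : (0 : ℝ) < n := by exact_mod_cast hn
  have : Continuous fun ε : ℝ => ArithmeticFunction.vonMangoldt n / (n : ℝ) ^ (1 + ε) :=
    continuous_const.div (Continuous.rpow (by fun_prop) (by fun_prop) fun _ => .inl hn'.ne')
      fun _ => (Real.rpow_pos_of_pos hn' _).ne'
  simpa using (this.tendsto 0).mono_left nhdsWithin_le_nhds

lemma tendsto_re_fejerError (T y : ℝ) : Tendsto (fun ε : ℝ => (fejerError T ε y).re)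
    (𝓝[>] 0) (𝓝 (fejerError T 0 y).re) :=
  ((Complex.continuous_re.comp (continuous_fejerError T y)).tendsto 0).mono_left
    nhdsWithin_le_nhds

lemma vonMangoldt_fejer_nonneg {T : ℝ} (hT : 0 < T) (y : ℝ) (n : ℕ) :
    0 ≤ ArithmeticFunction.vonMangoldt n / (n : ℝ) * fejer T (Real.log n - y) :=
  mul_nonneg (div_nonneg ArithmeticFunction.vonMangoldt_nonneg (by positivity))
    (fejer_nonneg hT _)

lemma sum_vonMangoldt_fejer_le {T : ℝ} (hT : 0 < T) (y : ℝ) (s : Finset ℕ) :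
    ∑ n ∈ s, ArithmeticFunction.vonMangoldt n / (n : ℝ) * fejer T (Real.log n - y) ≤
      (∫ v, fejer T v) + (fejerError T 0 y).re := by
  refine le_of_tendsto_of_tendsto
    (tendsto_finsetSum s fun n _ => (tendsto_vonMangoldt_div_rpow n).mul_const _)
    ((tendsto_re_fejerError T y).const_add _) ?_
  filter_upwards [self_mem_nhdsWithin] with ε hε
  have hε : 0 < ε := hε
  have h := hasSum_vonMangoldt_fejer hT hε y
  refine (sum_le_hasSum s (fun n _ => mul_nonneg (div_nonneg
    ArithmeticFunction.vonMangoldt_nonneg (by positivity)) (fejer_nonneg hT _)) h).trans ?_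
  gcongr
  have hi := (integrable_fejer hT).comp_sub_right y
  calc ∫ v in Ioi (0 : ℝ), Real.exp (-ε * v) * fejer T (v - y)
      ≤ ∫ v in Ioi (0 : ℝ), fejer T (v - y) := by
        refine integral_mono_of_nonneg (ae_of_all _ fun v => mul_nonneg (Real.exp_pos _).le
          (fejer_nonneg hT _)) hi.integrableOn ?_
        filter_upwards [ae_restrict_mem measurableSet_Ioi] with v hv
        have hv : 0 < v := hv
        refine mul_le_of_le_one_left (fejer_nonneg hT _) (Real.exp_le_one_iff.2 ?_)
        nlinarith
    _ ≤ ∫ v, fejer T (v - y) :=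
        setIntegral_le_integral hi (ae_of_all _ fun v => fejer_nonneg hT _)
    _ = ∫ v, fejer T v := integral_sub_right_eq_self _ y

lemma summable_vonMangoldt_fejer {T : ℝ} (hT : 0 < T) (y : ℝ) : Summable fun n : ℕ =>
    ArithmeticFunction.vonMangoldt n / (n : ℝ) * fejer T (Real.log n - y) :=
  summable_of_sum_le (vonMangoldt_fejer_nonneg hT y) (sum_vonMangoldt_fejer_le hT y)

lemma tsum_vonMangoldt_fejer_le {T : ℝ} (hT : 0 < T) (y : ℝ) :
    ∑' n : ℕ, ArithmeticFunction.vonMangoldt n / (n : ℝ) * fejer T (Real.log n - y) ≤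
      (∫ v, fejer T v) + (fejerError T 0 y).re :=
  (summable_vonMangoldt_fejer hT y).tsum_le_of_sum_le (sum_vonMangoldt_fejer_le hT y)

lemma le_tsum_vonMangoldt_fejer {T y : ℝ} (hT : 0 < T) (hy : 0 ≤ y) :
    1 / 2 + (fejerError T 0 y).re ≤
      ∑' n : ℕ, ArithmeticFunction.vonMangoldt n / (n : ℝ) * fejer T (Real.log n - y) := by
  have hlim : Tendsto (fun ε : ℝ => Real.exp (-ε * (y + 1 / T)) / 2 + (fejerError T ε y).re)
      (𝓝[>] 0) (𝓝 (1 / 2 + (fejerError T 0 y).re)) := by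
    refine Tendsto.add ?_ (tendsto_re_fejerError T y)
    have : Continuous fun ε : ℝ => Real.exp (-ε * (y + 1 / T)) / 2 := by fun_prop
    simpa using (this.tendsto 0).mono_left nhdsWithin_le_nhds
  refine le_of_tendsto hlim ?_
  filter_upwards [self_mem_nhdsWithin] with ε hε
  have hε : 0 < ε := hε
  have h := hasSum_vonMangoldt_fejer hT hε y
  have hmain : Real.exp (-ε * (y + 1 / T)) / 2 ≤
      ∫ v in Ioi (0 : ℝ), Real.exp (-ε * v) * fejer T (v - y) := by
    have hi : IntegrableOn (fun v => Real.exp (-ε * v) * fejer T (v - y)) (Ioi 0) := by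
      refine ((integrable_fejer hT).comp_sub_right y).integrableOn.mono'
        (Continuous.aestronglyMeasurable ?_) ?_
      · have := continuous_fejer T
        fun_prop
      · filter_upwards [ae_restrict_mem measurableSet_Ioi] with v hv
        have hv : 0 < v := hv
        rw [Real.norm_of_nonneg (mul_nonneg (Real.exp_pos _).le (fejer_nonneg hT _))]
        refine mul_le_of_le_one_left (fejer_nonneg hT _) (Real.exp_le_one_iff.2 ?_)
        nlinarith
    have hsub : Ioc y (y + 1 / T) ⊆ Ioi 0 := fun v hv => hy.trans_lt hv.1
    calc Real.exp (-ε * (y + 1 / T)) / 2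
        = ∫ v in Ioc y (y + 1 / T), Real.exp (-ε * (y + 1 / T)) * (T / 2) := by
          rw [setIntegral_const, Real.volume_real_Ioc_of_le (by linarith [one_div_pos.2 hT])]
          simp
          field_simp
      _ ≤ ∫ v in Ioc y (y + 1 / T), Real.exp (-ε * v) * fejer T (v - y) := by
          refine setIntegral_mono_on (integrableOn_const (by simp)) (hi.mono_set hsub) measurableSet_Ioc
            fun v hv => ?_
          have h1 : T * (v - y) ≤ 1 := by
            have := hv.2
            calc T * (v - y) ≤ T * (1 / T) := by gcongr; linarith
              _ = 1 := by field_simp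
          have h2 : Real.exp (-ε * (y + 1 / T)) ≤ Real.exp (-ε * v) := by
            refine Real.exp_le_exp.2 ?_
            nlinarith [hv.2]
          have h3 := half_le_fejer hT (sub_nonneg.2 hv.1.le) h1
          gcongr
      _ ≤ _ := setIntegral_mono_set hi (ae_of_all _ fun v =>
          mul_nonneg (Real.exp_pos _).le (fejer_nonneg hT _)) (ae_of_all _ hsub)
  refine (add_le_add_left hmain _).trans ?_
  rw [← h.tsum_eq]
  refine h.summable.tsum_le_tsum (fun n => ?_) (summable_vonMangoldt_fejer hT y)
  refine mul_le_mul_of_nonneg_right ?_ (fejer_nonneg hT _)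
  rcases Nat.eq_zero_or_pos n with rfl | hn
  · simp
  · have hn' : (1 : ℝ) ≤ n := by exact_mod_cast hn
    refine div_le_div_of_nonneg_left ArithmeticFunction.vonMangoldt_nonneg (by linarith) ?_
    conv_lhs => rw [← Real.rpow_one (n : ℝ)]
    exact Real.rpow_le_rpow_of_exponent_le hn' (by linarith)

/-- The natural numbers whose logarithm is within `δ` of `y`. -/
noncomputable def logWindow (δ y : ℝ) : Finset ℕ :=
  (Finset.range (⌊Real.exp (y + δ)⌋₊ + 1)).filter fun n => |Real.log n - y| ≤ δ

lemma mem_logWindow {δ y : ℝ} {n : ℕ} (h : |Real.log n - y| ≤ δ) : n ∈ logWindow δ y := by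
  refine Finset.mem_filter.2 ⟨Finset.mem_range.2 (Nat.lt_succ_of_le (Nat.le_floor ?_)), h⟩
  rcases Nat.eq_zero_or_pos n with rfl | hn
  · simpa using (Real.exp_pos _).le
  · rw [← Real.log_le_iff_le_exp (by exact_mod_cast hn)]
    linarith [(abs_le.1 h).2]

lemma fejer_le {T : ℝ} (hT : 0 < T) (v : ℝ) : fejer T v ≤ T := by
  have := sq_le_one_iff_abs_le_one _ |>.2 (Real.abs_sinc_le_one (T * v / 2))
  unfold fejer
  nlinarith

lemma exists_le_sum_logWindow {δ : ℝ} (hδ : 0 < δ) : ∃ c : ℝ, 0 < c ∧ ∀ᶠ y in atTop,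
    c ≤ ∑ n ∈ logWindow δ y, ArithmeticFunction.vonMangoldt n / (n : ℝ) := by
  obtain ⟨C, hC, hfej⟩ := exists_fejer_le hδ
  set J := ∫ v, fejer 1 v
  have hJ : 0 ≤ J := integral_nonneg fun v => fejer_nonneg one_pos v
  set T := 8 * C * (2 * (J + 1)) with hTdef
  have hT : 0 < T := by positivity
  have hre : ∀ {T : ℝ}, 0 < T → Tendsto (fun y => (fejerError T 0 y).re) atTop (𝓝 0) :=
    fun hT => by
      simpa [Function.comp_def] using (Complex.continuous_re.tendsto 0).comp (tendsto_fejerError _ hT)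
  have e1 := (hre hT).eventually (lt_mem_nhds (show (-1 / 8 : ℝ) < 0 by norm_num))
  have e2 := (hre one_pos).eventually (gt_mem_nhds (show (0 : ℝ) < 1 by norm_num))
  have e3 := (tendsto_atTop_add_const_right atTop (-1) tendsto_id).eventually e2
  refine ⟨1 / (4 * T), by positivity, ?_⟩
  filter_upwards [e1, e2, e3, eventually_ge_atTop 0] with y h1 h2 h3 hy
  have hlow := le_tsum_vonMangoldt_fejer hT hy
  have hup := tsum_vonMangoldt_fejer_le one_pos y
  have hup' := tsum_vonMangoldt_fejer_le one_pos (y + -1)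
  simp only [id] at h3
  set a : ℕ → ℝ := fun n => ArithmeticFunction.vonMangoldt n / (n : ℝ)
  have ha : ∀ n, 0 ≤ a n := fun n =>
    div_nonneg ArithmeticFunction.vonMangoldt_nonneg (by positivity)
  have s1 := summable_vonMangoldt_fejer one_pos y
  have s2 := summable_vonMangoldt_fejer one_pos (y + -1)
  have s3 : Summable fun n => if n ∈ logWindow δ y then a n * T else 0 :=
    summable_of_ne_finset_zero (s := logWindow δ y) fun n hn => by simp [hn]
  have hpt : ∀ n : ℕ, a n * fejer T (Real.log n - y) ≤
      (if n ∈ logWindow δ y then a n * T else 0) + C / T * (a n * fejer 1 (Real.log n - y)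
        + a n * fejer 1 (Real.log n - (y + -1))) := by
    intro n
    have hr : 0 ≤ C / T * (a n * fejer 1 (Real.log n - y)
        + a n * fejer 1 (Real.log n - (y + -1))) :=
      mul_nonneg (by positivity) (add_nonneg (mul_nonneg (ha n) (fejer_nonneg one_pos _))
        (mul_nonneg (ha n) (fejer_nonneg one_pos _)))
    split_ifs with h
    · nlinarith [mul_le_mul_of_nonneg_left (fejer_le hT (Real.log n - y)) (ha n)]
    · have hd : δ ≤ |Real.log n - y| := by
        by_contra! hd
        exact h (mem_logWindow hd.le)
      have := hfej T hT _ hd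
      rw [zero_add, show Real.log n - (y + -1) = Real.log n - y + 1 by ring, ← mul_add,
        mul_left_comm]
      exact mul_le_mul_of_nonneg_left this (ha n)
  have hw : ∑' n, (if n ∈ logWindow δ y then a n * T else 0) =
      (∑ n ∈ logWindow δ y, a n) * T := by
    rw [tsum_eq_sum (s := logWindow δ y) (fun n hn => by simp [hn]),
      Finset.sum_congr rfl (fun n hn => if_pos hn), Finset.sum_mul]
  have htot := (summable_vonMangoldt_fejer hT y).tsum_le_tsum hpt
    (s3.add ((s1.add s2).mul_left _))
  rw [s3.tsum_add ((s1.add s2).mul_left _), tsum_mul_left, s1.tsum_add s2,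
    hw] at htot
  have hsm : C / T * ((∑' n : ℕ, a n * fejer 1 (Real.log n - y)) +
      ∑' n : ℕ, a n * fejer 1 (Real.log n - (y + -1))) ≤ 1 / 8 := by
    calc _ ≤ C / T * (2 * (J + 1)) := by
          gcongr
          linarith
      _ = 1 / 8 := by rw [hTdef]; field_simp
  rw [div_le_iff₀ (by positivity)]
  linarith

/-- Any interval `[X, (1 + δ) X]` with `X` large contains many primes. -/
theorem eventually_exists_many_primes {δ : ℝ} (hδ : 0 < δ) (K : ℕ) : ∀ᶠ X : ℝ in atTop,
    ∃ S : Finset ℕ, K ≤ S.card ∧ ∀ p ∈ S, p.Prime ∧ X ≤ p ∧ (p : ℝ) ≤ (1 + δ) * X := by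
  set η := Real.log (1 + δ) / 2 with hη
  have hηpos : 0 < η := by
    have := Real.log_pos (show 1 < 1 + δ by linarith)
    positivity
  obtain ⟨c, hc, hev⟩ := exists_le_sum_logWindow hηpos
  have hsum := ArithmeticFunction.vonMangoldt.summable_residueClass_non_primes_div (1 : ZMod 1)
  have hres : ∀ n : ℕ, ArithmeticFunction.vonMangoldt.residueClass (1 : ZMod 1) n =
      ArithmeticFunction.vonMangoldt n := fun n => by
    rw [ArithmeticFunction.vonMangoldt.residueClass, Set.indicator_of_mem]
    exact Subsingleton.elim _ _
  simp only [hres] at hsum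
  obtain ⟨s, hs⟩ := summable_iff_vanishing_norm.1 hsum (c / 2) (by positivity)
  have hdisj : ∀ᶠ y in atTop, Disjoint (logWindow η y) s := by
    have : ∀ᶠ y in atTop, ∀ n ∈ s, Real.log n + η < y := by
      rw [Filter.eventually_all_finset]
      exact fun n _ => eventually_gt_atTop _
    filter_upwards [this] with y hy
    refine Finset.disjoint_left.2 fun n hn hns => ?_
    have := (abs_le.1 (Finset.mem_filter.1 hn).2).1
    linarith [hy n hns]
  have hsmall : ∀ᶠ y : ℝ in atTop, K * ((y + η) / Real.exp (y - η)) < c / 2 := by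
    have : Tendsto (fun y : ℝ => K * ((y + η) / Real.exp (y - η))) atTop (𝓝 0) := by
      have h1 := Real.tendsto_pow_mul_exp_neg_atTop_nhds_zero 1
      have h2 := Real.tendsto_pow_mul_exp_neg_atTop_nhds_zero 0
      have h3 := ((h1.add (h2.const_mul η)).const_mul (K * Real.exp η))
      simp only [pow_one, pow_zero, one_mul, mul_zero, add_zero] at h3
      refine h3.congr fun y => ?_
      rw [Real.exp_sub, Real.exp_neg]
      field_simp
    exact this.eventually (gt_mem_nhds (by positivity))
  have hall := hev.and (hdisj.and (hsmall.and (eventually_ge_atTop 0)))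
  have hlog : Tendsto (fun X : ℝ => Real.log X + η) atTop atTop :=
    tendsto_atTop_add_const_right _ _ Real.tendsto_log_atTop
  filter_upwards [hlog.eventually hall, eventually_gt_atTop 0] with X ⟨h1, h2, h3, h4⟩ hX
  set y := Real.log X + η with hy
  refine ⟨(logWindow η y).filter Nat.Prime, ?_, fun p hp => ?_⟩
  · by_contra! hcard
    have hnp := hs _ h2
    have hsplit : ∑ n ∈ logWindow η y, ArithmeticFunction.vonMangoldt n / (n : ℝ) =
        ∑ n ∈ logWindow η y, (if n.Prime then 0 else ArithmeticFunction.vonMangoldt n) / (n : ℝ) +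
        ∑ n ∈ (logWindow η y).filter Nat.Prime,
          ArithmeticFunction.vonMangoldt n / (n : ℝ) := by
      rw [Finset.sum_filter, ← Finset.sum_add_distrib]
      refine Finset.sum_congr rfl fun n _ => ?_
      split_ifs <;> simp
    have hpr : ∑ n ∈ (logWindow η y).filter Nat.Prime,
        ArithmeticFunction.vonMangoldt n / (n : ℝ) ≤ K * ((y + η) / Real.exp (y - η)) := by
      refine (Finset.sum_le_card_nsmul _ _ ((y + η) / Real.exp (y - η)) fun n hn => ?_).trans ?_
      · obtain ⟨hn1, hn2⟩ := Finset.mem_filter.1 hn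
        have habs := abs_le.1 (Finset.mem_filter.1 hn1).2
        have hpos : (0 : ℝ) < n := by exact_mod_cast hn2.pos
        rw [ArithmeticFunction.vonMangoldt_apply_prime hn2]
        refine div_le_div₀ (by linarith) (by linarith) (Real.exp_pos _) ?_
        rw [← Real.le_log_iff_exp_le hpos]
        linarith
      · rw [nsmul_eq_mul]
        gcongr
    have := (Real.le_norm_self _).trans_lt hnp
    linarith
  · obtain ⟨hn1, hn2⟩ := Finset.mem_filter.1 hp
    have habs := abs_le.1 (Finset.mem_filter.1 hn1).2
    have hpos : (0 : ℝ) < p := by exact_mod_cast hn2.pos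
    refine ⟨hn2, ?_, ?_⟩
    · rw [← Real.log_le_log_iff hX hpos]; linarith
    · rw [← Real.log_le_log_iff hpos (by positivity), Real.log_mul (by positivity) hX.ne']
      linarith

open Complex in
/-- The theta function with characteristic `(1/2, 0)`. -/
noncomputable def thetaHalf (z τ : ℂ) : ℂ :=
  cexp (Real.pi * I * τ / 4 + Real.pi * I * z) * jacobiTheta₂ (z + τ / 2) τ

open Complex in
lemma jacobiTheta₂_add_one_right (z τ : ℂ) :
    jacobiTheta₂ z (τ + 1) = jacobiTheta₂ (z + 1 / 2) τ := by
  refine tsum_congr fun n => ?_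
  rw [jacobiTheta₂_term, jacobiTheta₂_term]
  obtain ⟨k, hk⟩ := Int.even_mul_succ_self n
  have hk' : (n : ℂ) ^ 2 = 2 * k - n := by
    have : (n : ℂ) * (n + 1) = k + k := by exact_mod_cast congrArg (Int.cast : ℤ → ℂ) hk
    linear_combination this
  refine Complex.exp_eq_exp_iff_exists_int.2 ⟨k - n, ?_⟩
  push_cast
  linear_combination (Real.pi * I) * hk'

open Complex in
lemma thetaHalf_add_one_right (z τ : ℂ) :
    thetaHalf z (τ + 1) = cexp (Real.pi * I / 4) * thetaHalf z τ := by
  have : jacobiTheta₂ (z + (τ + 1) / 2) (τ + 1) = jacobiTheta₂ (z + τ / 2) τ := by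
    rw [jacobiTheta₂_add_one_right, ← jacobiTheta₂_add_left (z + τ / 2)]
    congr 1
    ring
  rw [thetaHalf, thetaHalf, this, ← mul_assoc, ← Complex.exp_add]
  ring_nf

open Complex in
/-- The automorphy factor of the theta functions under `τ ↦ -1/τ`. -/
noncomputable def thetaFactor (z τ : ℂ) : ℂ :=
  (-I * τ) ^ (1 / 2 : ℂ) * cexp (Real.pi * I * z ^ 2 / τ)

open Complex in
lemma jacobiTheta₂_div_neg_inv (z : ℂ) {τ : ℂ} (hτ : τ ≠ 0) :
    jacobiTheta₂ (z / τ) (-1 / τ) = thetaFactor z τ * jacobiTheta₂ z τ := by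
  rw [jacobiTheta₂_functional_equation z τ, thetaFactor]
  have h1 : (-I * τ) ^ (1 / 2 : ℂ) ≠ 0 := by
    rw [Ne, cpow_eq_zero_iff]
    simp [hτ]
  have h2 : cexp (Real.pi * I * z ^ 2 / τ) * cexp (-Real.pi * I * z ^ 2 / τ) = 1 := by
    rw [← Complex.exp_add, ← Complex.exp_zero]
    ring_nf
  calc jacobiTheta₂ (z / τ) (-1 / τ)
      = ((-I * τ) ^ (1 / 2 : ℂ) * (1 / (-I * τ) ^ (1 / 2 : ℂ))) *
        (cexp (Real.pi * I * z ^ 2 / τ) * cexp (-Real.pi * I * z ^ 2 / τ)) *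
        jacobiTheta₂ (z / τ) (-1 / τ) := by rw [h2, mul_one_div_cancel h1]; ring
    _ = _ := by ring

open Complex in
lemma jacobiTheta₂_div_add_half_neg_inv (z : ℂ) {τ : ℂ} (hτ : τ ≠ 0) :
    jacobiTheta₂ (z / τ + 1 / 2) (-1 / τ) = thetaFactor z τ * thetaHalf z τ := by
  have h : z / τ + 1 / 2 = (z + τ / 2) / τ := by field_simp
  rw [h, jacobiTheta₂_div_neg_inv _ hτ, thetaFactor, thetaFactor, thetaHalf]
  have h2 : cexp (Real.pi * I * (z + τ / 2) ^ 2 / τ) = cexp (Real.pi * I * z ^ 2 / τ) *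
      cexp (Real.pi * I * τ / 4 + Real.pi * I * z) := by
    rw [← Complex.exp_add]
    congr 1
    field_simp
    ring
  rw [h2]
  ring

open Complex in
lemma thetaHalf_div_neg_inv (z : ℂ) {τ : ℂ} (hτ : τ ≠ 0) :
    thetaHalf (z / τ) (-1 / τ) = thetaFactor z τ * jacobiTheta₂ (z + 1 / 2) τ := by
  have h : z / τ + -1 / τ / 2 = (z - 1 / 2) / τ := by field_simp; ring
  have h1 : jacobiTheta₂ (z - 1 / 2) τ = jacobiTheta₂ (z + 1 / 2) τ := by
    rw [← jacobiTheta₂_add_left (z - 1 / 2)]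
    congr 1
    ring
  rw [thetaHalf, h, jacobiTheta₂_div_neg_inv _ hτ, thetaFactor, thetaFactor, h1]
  have h2 : cexp (Real.pi * I * z ^ 2 / τ) = cexp (Real.pi * I * (-1 / τ) / 4 +
      Real.pi * I * (z / τ)) * cexp (Real.pi * I * (z - 1 / 2) ^ 2 / τ) := by
    rw [← Complex.exp_add]
    congr 1
    field_simp
    ring
  rw [h2]
  ring

open Complex in
/-- The total size of the differences of products of theta functions in directions `v`, `w`. -/
noncomputable def thetaDiff (v w : Fin 4 → ℝ) (l τ : ℂ) : ℝ :=
  ‖∏ j, jacobiTheta₂ (l * v j) τ - ∏ j, jacobiTheta₂ (l * w j) τ‖ +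
  ‖∏ j, jacobiTheta₂ (l * v j + 1 / 2) τ - ∏ j, jacobiTheta₂ (l * w j + 1 / 2) τ‖ +
  ‖∏ j, thetaHalf (l * v j) τ - ∏ j, thetaHalf (l * w j) τ‖

lemma thetaDiff_add_one (v w : Fin 4 → ℝ) (l τ : ℂ) :
    thetaDiff v w l (τ + 1) = thetaDiff v w l τ := by
  have h : ∀ z : ℂ, jacobiTheta₂ (z + 1 / 2 + 1 / 2) τ = jacobiTheta₂ z τ := fun z => by
    rw [← jacobiTheta₂_add_left z]
    congr 1
    ring
  have hE : ‖∏ _j : Fin 4, Complex.exp (Real.pi * Complex.I / 4)‖ = 1 := by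
    simp [Complex.norm_exp]
  simp only [thetaDiff, jacobiTheta₂_add_one_right, h, thetaHalf_add_one_right,
    Finset.prod_mul_distrib, ← mul_sub, norm_mul]
  rw [hE, one_mul, add_comm ‖_‖]

open Complex in
lemma prod_thetaFactor {v : Fin 4 → ℝ} (hv : ∑ j, v j ^ 2 = 1) (l τ : ℂ) :
    ∏ j, thetaFactor (l * v j) τ = -τ ^ 2 * cexp (Real.pi * (l ^ 2 / τ) * I) := by
  have hv' : ∑ j, (v j : ℂ) ^ 2 = 1 := by exact_mod_cast congrArg (fun x : ℝ => (x : ℂ)) hv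
  have h1 : ((-I * τ) ^ (1 / 2 : ℂ)) ^ 4 = -τ ^ 2 := by
    rw [show 4 = 2 * 2 by norm_num, pow_mul, ← Complex.cpow_nat_mul]
    norm_num
    rw [mul_pow]
    simp
  simp only [thetaFactor, Finset.prod_mul_distrib, Finset.prod_const, Finset.card_univ,
    Fintype.card_fin, h1, ← Complex.exp_sum]
  congr 2
  calc ∑ j, Real.pi * I * (l * v j) ^ 2 / τ = Real.pi * I * l ^ 2 / τ * ∑ j, (v j : ℂ) ^ 2 := by
        rw [Finset.mul_sum]; exact Finset.sum_congr rfl fun j _ => by ring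
    _ = _ := by rw [hv']; ring

lemma thetaDiff_neg_inv {v w : Fin 4 → ℝ} (hv : ∑ j, v j ^ 2 = 1) (hw : ∑ j, w j ^ 2 = 1)
    (l : ℂ) {τ : ℂ} (hτ : 0 < τ.im) :
    thetaDiff v w (l / τ) (-1 / τ) =
      ‖τ‖ ^ 2 * Real.exp (-Real.pi * (l ^ 2 / τ).im) * thetaDiff v w l τ := by
  have hτ0 : τ ≠ 0 := by rintro rfl; simp at hτ
  have hd : ∀ x : ℝ, l / τ * x = l * x / τ := fun x => by ring
  simp only [thetaDiff, hd, jacobiTheta₂_div_neg_inv _ hτ0, jacobiTheta₂_div_add_half_neg_inv _ hτ0,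
    thetaHalf_div_neg_inv _ hτ0, Finset.prod_mul_distrib, prod_thetaFactor hv,
    prod_thetaFactor hw, ← mul_sub,
    norm_mul, norm_neg, norm_pow, Complex.norm_exp, Complex.mul_I_re, Complex.im_ofReal_mul]
  rw [neg_mul]
  ring

/-- The invariant version of `thetaDiff`. -/
noncomputable def thetaDiffInv (v w : Fin 4 → ℝ) (l τ : ℂ) : ℝ :=
  τ.im * Real.exp (-Real.pi * (l.im ^ 2 / τ.im)) * thetaDiff v w l τ

lemma thetaDiffInv_add_one (v w : Fin 4 → ℝ) (l τ : ℂ) :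
    thetaDiffInv v w l (τ + 1) = thetaDiffInv v w l τ := by
  simp [thetaDiffInv, thetaDiff_add_one]

lemma im_neg_one_div (τ : ℂ) : (-1 / τ).im = τ.im / ‖τ‖ ^ 2 := by
  rw [neg_div, one_div, Complex.neg_im, Complex.inv_im, Complex.sq_norm]
  ring

lemma thetaDiffInv_neg_inv {v w : Fin 4 → ℝ} (hv : ∑ j, v j ^ 2 = 1) (hw : ∑ j, w j ^ 2 = 1)
    (l : ℂ) {τ : ℂ} (hτ : 0 < τ.im) :
    thetaDiffInv v w (l / τ) (-1 / τ) = thetaDiffInv v w l τ := by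
  have hτ0 : τ ≠ 0 := by rintro rfl; simp at hτ
  have hn : 0 < ‖τ‖ ^ 2 := by positivity
  rw [thetaDiffInv, thetaDiffInv, thetaDiff_neg_inv hv hw l hτ, im_neg_one_div]
  have key : (l / τ).im ^ 2 / (τ.im / ‖τ‖ ^ 2) + (l ^ 2 / τ).im = l.im ^ 2 / τ.im := by
    have hs := Complex.sq_norm τ
    rw [Complex.normSq_apply] at hs
    have hs0 : τ.re * τ.re + τ.im * τ.im ≠ 0 := by rw [← hs]; positivity
    rw [hs, Complex.div_im, Complex.div_im, Complex.normSq_apply, pow_two l]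
    simp only [Complex.mul_re, Complex.mul_im]
    field_simp
    ring
  rw [← key, mul_add, Real.exp_add]
  field_simp

open UpperHalfPlane in
/-- A bound for `thetaDiffInv` on the fundamental domain extends to the upper half plane. -/
lemma thetaDiffInv_le_of_fd {v w : Fin 4 → ℝ} (hv : ∑ j, v j ^ 2 = 1) (hw : ∑ j, w j ^ 2 = 1)
    {B C : ℝ} (h : ∀ τ : ℂ, 1 / 2 ≤ τ.im → ∀ l : ℂ, ‖l‖ ^ 2 ≤ B * τ.im →
      thetaDiffInv v w l τ ≤ C) (τ : ℍ) (l : ℂ) (hl : ‖l‖ ^ 2 ≤ B * τ.im) :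
    thetaDiffInv v w l τ ≤ C := by
  let Q : ℍ → Prop := fun τ => ∀ l : ℂ, ‖l‖ ^ 2 ≤ B * τ.im → thetaDiffInv v w l τ ≤ C
  have hT : ∀ τ : ℍ, Q (ModularGroup.T • τ) ↔ Q τ := by
    intro τ
    have h1 : ((ModularGroup.T • τ : ℍ) : ℂ) = τ + 1 := by
      rw [modular_T_smul, coe_vadd, add_comm]; simp
    have h2 : (ModularGroup.T • τ : ℍ).im = τ.im := by
      rw [← coe_im, h1]; simp
    simp only [Q, h1, h2, thetaDiffInv_add_one]
  have hS : ∀ τ : ℍ, Q (ModularGroup.S • τ) ↔ Q τ := by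
    intro τ
    have h1 : ((ModularGroup.S • τ : ℍ) : ℂ) = -1 / τ := by
      rw [modular_S_smul]; simp [neg_div, inv_neg]
    have hτ0 : (τ : ℂ) ≠ 0 := τ.ne_zero
    have h2 : (ModularGroup.S • τ : ℍ).im = τ.im / ‖(τ : ℂ)‖ ^ 2 := by
      rw [← coe_im, h1, im_neg_one_div, coe_im]
    have h3 : ∀ l : ℂ, ‖l / τ‖ ^ 2 ≤ B * (τ.im / ‖(τ : ℂ)‖ ^ 2) ↔ ‖l‖ ^ 2 ≤ B * τ.im := by
      intro l
      rw [norm_div, div_pow, ← mul_div_assoc, div_le_div_iff_of_pos_right (by positivity)]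
    simp only [Q, h1, h2]
    constructor
    · intro H l hl
      rw [← thetaDiffInv_neg_inv hv hw l τ.im_pos]
      exact H _ ((h3 l).2 hl)
    · intro H l hl
      have hl' : l = l * τ / τ := by field_simp
      rw [hl'] at hl ⊢
      rw [thetaDiffInv_neg_inv hv hw _ τ.im_pos]
      exact H _ ((h3 _).1 hl)
  have hall : ∀ (g : Matrix.SpecialLinearGroup (Fin 2) ℤ) (τ : ℍ), Q (g • τ) ↔ Q τ := by
    intro g
    have : g ∈ Subgroup.closure {ModularGroup.S, ModularGroup.T} := by
      simp [SpecialLinearGroup.SL2Z_generators]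
    induction this using Subgroup.closure_induction with
    | one => simp
    | mem g hg =>
      rcases hg with rfl | rfl
      · exact hS
      · exact hT
    | mul g h _ _ ig ih => exact fun τ => by rw [mul_smul, ig, ih]
    | inv g _ ig => exact fun τ => by rw [← ig, smul_inv_smul]
  obtain ⟨g, hg⟩ := ModularGroup.exists_smul_mem_fd τ
  refine (hall g τ).1 (fun l hl => h _ ?_ l hl) l hl
  have := ModularGroup.three_le_four_mul_im_sq_of_mem_fd hg
  have hp := (g • τ).im_pos
  rw [coe_im]
  nlinarith

lemma exp_neg_pi_mul_le {B y b m : ℝ} (hy : 0 < y) (hm : m ≠ 0) (hb : b ^ 2 ≤ B * y) :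
    Real.exp (-Real.pi * m ^ 2 * y - 2 * Real.pi * m * b) ≤
      Real.exp (2 * Real.pi * B) / y * (1 / m ^ 2) := by
  have hm2 : 0 < m ^ 2 := by positivity
  have hπ := Real.pi_gt_three
  have h1 : -(2 * m * b) ≤ m ^ 2 * y / 2 + 2 * B := by
    have h0 : 0 ≤ (m * y + 2 * b) ^ 2 := sq_nonneg _
    have h2 : -(2 * m * b) * y ≤ (m ^ 2 * y / 2 + 2 * B) * y := by nlinarith
    exact le_of_mul_le_mul_right h2 hy
  have h3 : -Real.pi * m ^ 2 * y - 2 * Real.pi * m * b ≤ 2 * Real.pi * B + -(m ^ 2 * y) := by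
    have := mul_le_mul_of_nonneg_left h1 Real.pi_pos.le
    have h4 : 0 < m ^ 2 * y := by positivity
    nlinarith
  refine (Real.exp_le_exp.2 h3).trans ?_
  rw [Real.exp_add, div_mul_eq_mul_div, mul_div_assoc]
  refine mul_le_mul_of_nonneg_left ?_ (Real.exp_pos _).le
  rw [Real.exp_neg, one_div, inv_div_left, mul_comm y]
  refine inv_anti₀ (by positivity) ?_
  linarith [Real.add_one_le_exp (m ^ 2 * y)]

lemma norm_jacobiTheta₂_sub_one_le {B : ℝ} {z τ : ℂ} (hτ : 0 < τ.im)
    (hz : z.im ^ 2 ≤ B * τ.im) : ‖jacobiTheta₂ z τ - 1‖ ≤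
      Real.exp (2 * Real.pi * B) / τ.im * ∑' n : ℤ, 1 / (n : ℝ) ^ 2 := by
  have hs : Summable fun n : ℤ => 1 / (n : ℝ) ^ 2 :=
    Real.summable_one_div_int_pow.2 one_lt_two
  have h1 : HasSum (fun n : ℤ => if n = 0 then (1 : ℂ) else 0) 1 := by
    simpa using hasSum_ite_eq (0 : ℤ) (1 : ℂ)
  have h := (hasSum_jacobiTheta₂_term z hτ).sub h1
  rw [← h.tsum_eq, ← tsum_mul_left]
  refine tsum_of_norm_bounded (hs.mul_left _).hasSum fun n => ?_
  rcases eq_or_ne n 0 with rfl | hn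
  · simp [jacobiTheta₂_term]
  · rw [if_neg hn, sub_zero, norm_jacobiTheta₂_term]
    exact exp_neg_pi_mul_le hτ (by exact_mod_cast hn) hz

lemma summable_one_div_int_add_half_sq :
    Summable fun n : ℤ => 1 / ((n : ℝ) + 1 / 2) ^ 2 := by
  have := (Real.summable_one_div_int_add_rpow (1 / 2) 2).2 one_lt_two
  simpa using this

lemma norm_thetaHalf_le {B : ℝ} {z τ : ℂ} (hτ : 0 < τ.im)
    (hz : z.im ^ 2 ≤ B * τ.im) : ‖thetaHalf z τ‖ ≤
      Real.exp (2 * Real.pi * B) / τ.im * ∑' n : ℤ, 1 / ((n : ℝ) + 1 / 2) ^ 2 := by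
  have h := (hasSum_jacobiTheta₂_term (z + τ / 2) hτ).mul_left
    (Complex.exp (Real.pi * Complex.I * τ / 4 + Real.pi * Complex.I * z))
  rw [thetaHalf, ← h.tsum_eq, ← tsum_mul_left]
  refine tsum_of_norm_bounded (summable_one_div_int_add_half_sq.mul_left _).hasSum fun n => ?_
  have hn : (n : ℝ) + 1 / 2 ≠ 0 := by
    intro h0
    have : (2 * n + 1 : ℤ) = 0 := by
      have : (2 * n + 1 : ℝ) = 0 := by linarith
      exact_mod_cast this
    omega
  refine le_trans (le_of_eq ?_) (exp_neg_pi_mul_le hτ hn hz)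
  rw [norm_mul, norm_jacobiTheta₂_term, Complex.norm_exp, ← Real.exp_add]
  have : (Real.pi * Complex.I * τ / 4 + Real.pi * Complex.I * z) =
    ((Real.pi : ℝ) : ℂ) * (τ * (1 / 4 : ℝ) + z) * Complex.I := by push_cast; ring
  rw [this, Complex.mul_I_re, Complex.im_ofReal_mul, Complex.add_im, Complex.im_mul_ofReal]
  have h2 : (z + τ / 2).im = z.im + τ.im / 2 := by simp
  rw [h2]
  ring_nf

lemma norm_prod_sub_one_le {x : Fin 4 → ℂ} {ε : ℝ} (hx : ∀ j, ‖x j - 1‖ ≤ ε) :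
    ‖∏ j, x j - 1‖ ≤ 4 * ε * Real.exp (4 * ε) := by
  have h := Finset.norm_prod_one_add_sub_one_le Finset.univ (fun j => x j - 1)
  simp only [add_sub_cancel] at h
  have h1 : ∑ j, ‖x j - 1‖ ≤ 4 * ε := by
    simpa using Finset.sum_le_card_nsmul Finset.univ (fun j => ‖x j - 1‖) ε fun j _ => hx j
  have h2 := Real.exp_le_exp.2 h1
  have h3 : (1 - 4 * ε) * Real.exp (4 * ε) ≤ 1 := by
    calc _ ≤ Real.exp (-(4 * ε)) * Real.exp (4 * ε) := by
          gcongr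
          linarith [Real.add_one_le_exp (-(4 * ε))]
      _ = 1 := by rw [← Real.exp_add]; simp
  linarith

lemma exists_thetaDiffInv_le (B : ℝ) : ∃ C : ℝ, ∀ v w : Fin 4 → ℝ, ∑ j, v j ^ 2 = 1 →
    ∑ j, w j ^ 2 = 1 → ∀ τ : UpperHalfPlane, ∀ l : ℂ, ‖l‖ ^ 2 ≤ B * τ.im →
      thetaDiffInv v w l τ ≤ C := by
  set D := Real.exp (2 * Real.pi * B) * ((∑' n : ℤ, 1 / (n : ℝ) ^ 2) +
    ∑' n : ℤ, 1 / ((n : ℝ) + 1 / 2) ^ 2) with hD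
  have hZ : 0 ≤ ∑' n : ℤ, 1 / (n : ℝ) ^ 2 := tsum_nonneg fun n => by positivity
  have hZ' : 0 ≤ ∑' n : ℤ, 1 / ((n : ℝ) + 1 / 2) ^ 2 := tsum_nonneg fun n => by positivity
  have hD0 : 0 ≤ D := by positivity
  have hD1 : ∀ y : ℝ, 0 < y → Real.exp (2 * Real.pi * B) / y * ∑' n : ℤ, 1 / (n : ℝ) ^ 2 ≤
      D / y := fun y hy => by
    rw [hD, div_mul_eq_mul_div]; gcongr; linarith
  have hD2 : ∀ y : ℝ, 0 < y →
      Real.exp (2 * Real.pi * B) / y * ∑' n : ℤ, 1 / ((n : ℝ) + 1 / 2) ^ 2 ≤ D / y :=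
    fun y hy => by
    rw [hD, div_mul_eq_mul_div]; gcongr; linarith
  refine ⟨16 * D * Real.exp (8 * D) + 16 * D ^ 4, fun v w hv hw τ l hl =>
    thetaDiffInv_le_of_fd hv hw (fun τ hτ l hl => ?_) τ l hl⟩
  have hy : 0 < τ.im := by linarith
  have him : ∀ u : Fin 4 → ℝ, ∑ j, u j ^ 2 = 1 → ∀ j, (l * u j).im ^ 2 ≤ B * τ.im := by
    intro u hu j
    rw [Complex.im_mul_ofReal, mul_pow]
    have h1 : u j ^ 2 ≤ 1 := hu ▸
      Finset.single_le_sum (f := fun j => u j ^ 2) (fun i _ => sq_nonneg _) (Finset.mem_univ j)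
    have h2 : l.im ^ 2 ≤ ‖l‖ ^ 2 := by
      rw [Complex.sq_norm, Complex.normSq_apply]; nlinarith [sq_nonneg l.re]
    nlinarith [sq_nonneg l.im]
  set ε := D / τ.im with hε
  have hε0 : 0 ≤ ε := by positivity
  have hyε : τ.im * ε = D := by rw [hε]; field_simp
  have hε2 : ε ≤ 2 * D := by nlinarith
  have b1 : ∀ u : Fin 4 → ℝ, ∑ j, u j ^ 2 = 1 →
      ‖∏ j, jacobiTheta₂ (l * u j) τ - 1‖ ≤ 4 * ε * Real.exp (4 * ε) := fun u hu =>
    norm_prod_sub_one_le fun j =>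
      (norm_jacobiTheta₂_sub_one_le hy (him u hu j)).trans (hD1 _ hy)
  have b2 : ∀ u : Fin 4 → ℝ, ∑ j, u j ^ 2 = 1 →
      ‖∏ j, jacobiTheta₂ (l * u j + 1 / 2) τ - 1‖ ≤ 4 * ε * Real.exp (4 * ε) := fun u hu =>
    norm_prod_sub_one_le fun j =>
      (norm_jacobiTheta₂_sub_one_le hy (by simpa using him u hu j)).trans (hD1 _ hy)
  have b3 : ∀ u : Fin 4 → ℝ, ∑ j, u j ^ 2 = 1 →
      ‖∏ j, thetaHalf (l * u j) τ‖ ≤ ε ^ 4 := fun u hu => by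
    rw [norm_prod]
    refine (Finset.prod_le_prod (g := fun _ => ε) (fun j _ => norm_nonneg _)
      fun j _ => ?_).trans (by simp)
    exact (norm_thetaHalf_le hy (him u hu j)).trans (hD2 _ hy)
  have hd : thetaDiff v w l τ ≤ 16 * ε * Real.exp (4 * ε) + 2 * ε ^ 4 := by
    have t1 := norm_sub_le_norm_sub_add_norm_sub (∏ j, jacobiTheta₂ (l * v j) τ) 1
      (∏ j, jacobiTheta₂ (l * w j) τ)
    have t2 := norm_sub_le_norm_sub_add_norm_sub (∏ j, jacobiTheta₂ (l * v j + 1 / 2) τ) 1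
      (∏ j, jacobiTheta₂ (l * w j + 1 / 2) τ)
    rw [norm_sub_rev 1] at t1 t2
    have t3 := norm_sub_le (∏ j, thetaHalf (l * v j) τ) (∏ j, thetaHalf (l * w j) τ)
    rw [thetaDiff]
    linarith [b1 v hv, b1 w hw, b2 v hv, b2 w hw, b3 v hv, b3 w hw]
  have hexp : Real.exp (-Real.pi * (l.im ^ 2 / τ.im)) ≤ 1 := by
    rw [Real.exp_le_one_iff, neg_mul, neg_nonpos]
    positivity
  have hd0 : 0 ≤ thetaDiff v w l τ := by unfold thetaDiff; positivity
  calc thetaDiffInv v w l τ ≤ τ.im * 1 * (16 * ε * Real.exp (4 * ε) + 2 * ε ^ 4) := by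
        rw [thetaDiffInv]; gcongr
    _ = 16 * D * Real.exp (4 * ε) + 2 * D * ε ^ 3 := by rw [← hyε]; ring
    _ ≤ 16 * D * Real.exp (4 * (2 * D)) + 2 * D * (2 * D) ^ 3 := by gcongr
    _ = _ := by ring_nf

lemma hasSum_mul_prod {α β : Type*} {a : α → ℂ} {b : β → ℂ} {s t : ℂ}
    (ha : Summable fun x => ‖a x‖) (hb : Summable fun x => ‖b x‖) (hs : HasSum a s)
    (ht : HasSum b t) : (Summable fun p : α × β => ‖a p.1 * b p.2‖) ∧
      HasSum (fun p : α × β => a p.1 * b p.2) (s * t) := by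
  have h := ha.mul_norm hb
  exact ⟨h, hs.mul ht h.of_norm⟩

lemma hasSum_prod_pi {k : ℕ} (f : Fin k → ℤ → ℂ) (hf : ∀ i, Summable fun n => ‖f i n‖) :
    (Summable fun x : Fin k → ℤ => ‖∏ i, f i (x i)‖) ∧
      HasSum (fun x : Fin k → ℤ => ∏ i, f i (x i)) (∏ i, ∑' n, f i n) := by
  induction k with
  | zero =>
    refine ⟨(hasSum_unique _).summable, ?_⟩
    simp
  | succ k ih =>
    obtain ⟨h1, h2⟩ := ih (fun i => f i.succ) fun i => hf i.succ
    let e : ℤ × (Fin k → ℤ) ≃ (Fin (k + 1) → ℤ) := Fin.consEquiv fun _ => ℤ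
    have he : ∀ p : ℤ × (Fin k → ℤ), ∏ i, f i (e p i) = f 0 p.1 * ∏ i, f i.succ (p.2 i) := by
      intro p
      have h1 : e p 0 = p.1 := rfl
      have h2 : ∀ i : Fin k, e p i.succ = p.2 i := fun i => rfl
      simp only [Fin.prod_univ_succ, h1, h2]
    rw [← e.summable_iff, ← e.hasSum_iff, Fin.prod_univ_succ]
    simp only [Function.comp_def, he]
    have h3 := hf 0
    have h4 := h3.of_norm
    have h5 := h4.hasSum
    have h6 := hasSum_mul_prod h3 h1 h5 h2
    exact h6

lemma integral_exp_pi_mul_I (m : ℤ) :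
    ∫ u in (0 : ℝ)..2, Complex.exp (Real.pi * Complex.I * m * u) = if m = 0 then 2 else 0 := by
  split_ifs with h
  · subst h; simp
  · have hc : (Real.pi * Complex.I * m : ℂ) ≠ 0 := by
      simp [Real.pi_ne_zero, h]
    rw [integral_exp_mul_complex hc]
    have : Complex.exp (Real.pi * Complex.I * m * (2 : ℝ)) = 1 := by
      rw [Complex.exp_eq_one_iff]
      exact ⟨m, by push_cast; ring⟩
    rw [this]
    simp

/-- Bessel's inequality for absolutely convergent exponential series with integer frequencies. -/
lemma sum_norm_sq_fiber_le {ι : Type*} [Countable ι] {d : ι → ℂ} (hd : Summable fun x => ‖d x‖)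
    (N : ι → ℤ) {M : ℝ} (hM : ∀ u : ℝ,
      ‖∑' x, d x * Complex.exp (Real.pi * Complex.I * N x * u)‖ ≤ M) (P : Finset ℤ) :
    ∑ n ∈ P, ‖∑' x, if N x = n then d x else 0‖ ^ 2 ≤ M ^ 2 := by
  set D : ℝ → ℂ := fun u => ∑' x, d x * Complex.exp (Real.pi * Complex.I * N x * u)
  have hexp : ∀ (m : ℤ) (u : ℝ), ‖Complex.exp (Real.pi * Complex.I * m * u)‖ = 1 := by
    intro m u
    rw [show (Real.pi * Complex.I * m * u : ℂ) = ((Real.pi * m * u : ℝ) : ℂ) * Complex.I by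
      push_cast; ring, Complex.norm_exp_ofReal_mul_I]
  have hM0 : 0 ≤ M := (norm_nonneg _).trans (hM 0)
  have hDc : Continuous D := by
    refine continuous_tsum (u := fun x => ‖d x‖) (fun x => by fun_prop) hd fun x u => ?_
    rw [norm_mul, hexp, mul_one]
  have hL2 : MemLp D 2 (volume.restrict (Ioc 0 2)) :=
    MemLp.of_bound hDc.aestronglyMeasurable M (ae_of_all _ hM)
  have hcoef : ∀ n : ℤ, fourierCoeffOn (zero_lt_two (α := ℝ)) D n =
      ∑' x, if N x = n then d x else 0 := by
    intro n
    rw [fourierCoeffOn_eq_integral]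
    have h1 : ∀ u : ℝ, fourier (-n) (u : AddCircle ((2 : ℝ) - 0)) • D u =
        ∑' x, d x * Complex.exp (Real.pi * Complex.I * (N x - n : ℤ) * u) := by
      intro u
      rw [fourier_coe_apply, smul_eq_mul, ← tsum_mul_left]
      refine tsum_congr fun x => ?_
      rw [mul_left_comm, ← Complex.exp_add]
      congr 2
      push_cast
      field_simp
      ring
    simp only [h1]
    have h2 : HasSum (fun x => ∫ u in (0 : ℝ)..2,
        d x * Complex.exp (Real.pi * Complex.I * (N x - n : ℤ) * u))
        (∫ u in (0 : ℝ)..2, ∑' x, d x * Complex.exp (Real.pi * Complex.I * (N x - n : ℤ) * u)) := by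
      simp only [intervalIntegral.integral_of_le zero_le_two]
      refine hasSum_integral_of_summable_integral_norm (fun x => ?_) ?_
      · exact (Continuous.integrableOn_Icc (by fun_prop)).mono_set Ioc_subset_Icc_self
      · simp only [norm_mul, hexp, mul_one, integral_const]
        exact hd.mul_left _
    rw [← h2.tsum_eq, ← tsum_const_smul'']
    refine tsum_congr fun x => ?_
    rw [intervalIntegral.integral_const_mul, integral_exp_pi_mul_I]
    simp only [sub_eq_zero]
    split_ifs
    · rw [Complex.real_smul]; push_cast; ring
    · simp
  have h := hasSum_sq_fourierCoeffOn (zero_lt_two (α := ℝ)) hL2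
  simp only [hcoef] at h
  refine (sum_le_hasSum P (fun n _ => by positivity) h).trans ?_
  have hi : ∫ u in (0 : ℝ)..2, ‖D u‖ ^ 2 ≤ ∫ u in (0 : ℝ)..2, M ^ 2 := by
    refine intervalIntegral.integral_mono_on zero_le_two
      (Continuous.intervalIntegrable (by fun_prop) _ _) (by simp) fun u _ => ?_
    exact pow_le_pow_left₀ (norm_nonneg _) (hM u) 2
  rw [intervalIntegral.integral_const] at hi
  simp only [smul_eq_mul, sub_zero] at hi ⊢
  linarith

/-- The Gaussian weight on `ℤ⁴` centred at `R v`, at scale `R`. -/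
noncomputable def capWeight (A R : ℝ) (v : Fin 4 → ℝ) (x : Fin 4 → ℤ) : ℝ :=
  Real.exp (-Real.pi * A * (∑ j, (x j - R * v j) ^ 2) / R ^ 2)

lemma hasSum_capWeight {A R : ℝ} (hA : 0 < A) (hR : 0 < R) {v : Fin 4 → ℝ}
    (hv : ∑ j, v j ^ 2 = 1) (u : ℝ) :
    (Summable fun x => ‖(capWeight A R v x : ℂ)‖) ∧
    HasSum (fun x => (capWeight A R v x : ℂ) *
      Complex.exp (Real.pi * Complex.I * (∑ j, x j ^ 2 : ℤ) * u))
      (Real.exp (-Real.pi * A) * ∏ j, jacobiTheta₂ (-Complex.I * A / R * v j)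
        (u + Complex.I * (A / R ^ 2 : ℝ))) := by
  set τ : ℂ := u + Complex.I * (A / R ^ 2 : ℝ) with hτ
  set l : ℂ := -Complex.I * A / R with hl
  have hτ0 : 0 < τ.im := by
    rw [hτ, Complex.add_im, Complex.ofReal_im, Complex.I_mul_im, Complex.ofReal_re, zero_add]
    positivity
  have hs : ∀ j, HasSum (fun n => jacobiTheta₂_term n (l * v j) τ) (jacobiTheta₂ (l * v j) τ) :=
    fun j => hasSum_jacobiTheta₂_term _ hτ0
  obtain ⟨h1, h2⟩ := hasSum_prod_pi (fun j n => jacobiTheta₂_term n (l * v j) τ)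
    fun j => (hs j).summable.norm
  simp only [(hs _).tsum_eq] at h2
  have hRc : (R : ℂ) ≠ 0 := by exact_mod_cast hR.ne'
  have hvc : ∑ j, (v j : ℂ) ^ 2 = 1 := by exact_mod_cast congrArg (fun x : ℝ => (x : ℂ)) hv
  have key : ∀ x : Fin 4 → ℤ, (Real.exp (-Real.pi * A) : ℂ) *
      ∏ j, jacobiTheta₂_term (x j) (l * v j) τ = (capWeight A R v x : ℂ) *
        Complex.exp (Real.pi * Complex.I * (∑ j, x j ^ 2 : ℤ) * u) := by
    intro x
    simp only [jacobiTheta₂_term, capWeight]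
    rw [← Complex.exp_sum, Complex.ofReal_exp, Complex.ofReal_exp, ← Complex.exp_add,
      ← Complex.exp_add]
    congr 1
    have e1 : ∀ j, 2 * Real.pi * Complex.I * (x j) * (l * v j) +
        Real.pi * Complex.I * (x j) ^ 2 * τ = Real.pi * Complex.I * u * (x j : ℂ) ^ 2 -
          Real.pi * A / R ^ 2 * (x j - R * v j) ^ 2 + Real.pi * A * (v j : ℂ) ^ 2 := by
      intro j
      rw [hτ, hl]
      push_cast
      field_simp
      ring_nf
      rw [Complex.I_sq]
      ring
    simp only [e1, Finset.sum_add_distrib, Finset.sum_sub_distrib, ← Finset.mul_sum, hvc]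
    push_cast
    ring
  have h3 := h2.mul_left (Real.exp (-Real.pi * A) : ℂ)
  simp only [key] at h3
  refine ⟨?_, h3⟩
  have h4 := h1.mul_left ‖(Real.exp (-Real.pi * A) : ℂ)‖
  refine h4.congr fun x => ?_
  rw [← norm_mul, key, norm_mul, show (Real.pi * Complex.I * (∑ j, x j ^ 2 : ℤ) * u : ℂ) =
    ((Real.pi * (∑ j, x j ^ 2 : ℤ) * u : ℝ) : ℂ) * Complex.I by push_cast; ring,
    Complex.norm_exp_ofReal_mul_I, mul_one]

/-- The Gaussian-weighted number of representations of `n` as a sum of four squares. -/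
noncomputable def weightedCount (A R : ℝ) (v : Fin 4 → ℝ) (n : ℤ) : ℝ :=
  ∑' x : Fin 4 → ℤ, if ∑ j, x j ^ 2 = n then capWeight A R v x else 0

lemma exists_sum_sq_weightedCount_sub_le {A : ℝ} (hA : 0 < A) : ∃ C : ℝ, ∀ R : ℝ, 0 < R →
    ∀ v w : Fin 4 → ℝ, ∑ j, v j ^ 2 = 1 → ∑ j, w j ^ 2 = 1 → ∀ P : Finset ℤ,
      ∑ n ∈ P, (weightedCount A R v n - weightedCount A R w n) ^ 2 ≤ C * R ^ 4 := by
  obtain ⟨C, hC⟩ := exists_thetaDiffInv_le A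
  refine ⟨(C / A) ^ 2, fun R hR v w hv hw P => ?_⟩
  have hsum : ∀ v : Fin 4 → ℝ, ∑ j, v j ^ 2 = 1 → Summable fun x => ‖capWeight A R v x‖ := by
    intro v hv
    simpa using (hasSum_capWeight hA hR hv 0).1
  have hd : Summable fun x => ‖((capWeight A R v x - capWeight A R w x : ℝ) : ℂ)‖ := by
    simp only [Complex.norm_real]
    exact ((hsum v hv).of_norm.sub (hsum w hw).of_norm).norm
  have h := sum_norm_sq_fiber_le hd (fun x => ∑ j, x j ^ 2) (M := C / A * R ^ 2) (fun u => ?_) P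
  · calc _ = ∑ n ∈ P, ‖∑' x : Fin 4 → ℤ, if ∑ j, x j ^ 2 = n then
          ((capWeight A R v x - capWeight A R w x : ℝ) : ℂ) else 0‖ ^ 2 := by
          refine Finset.sum_congr rfl fun n _ => ?_
          have hind : ∀ v : Fin 4 → ℝ, ∑ j, v j ^ 2 = 1 → Summable fun x : Fin 4 → ℤ =>
              if ∑ j, x j ^ 2 = n then capWeight A R v x else 0 := fun v hv =>
            (hsum v hv).of_norm_bounded fun x => by
              split_ifs
              · exact le_rfl
              · simp
          rw [weightedCount, weightedCount, ← (hind v hv).tsum_sub (hind w hw)]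
          have : ∀ x : Fin 4 → ℤ, (if ∑ j, x j ^ 2 = n then
              ((capWeight A R v x - capWeight A R w x : ℝ) : ℂ) else 0) =
              (((if ∑ j, x j ^ 2 = n then capWeight A R v x else 0) -
              if ∑ j, x j ^ 2 = n then capWeight A R w x else 0 : ℝ) : ℂ) := by
            intro x
            split_ifs <;> simp
          simp only [this]
          rw [← Complex.ofReal_tsum, Complex.norm_real, Real.norm_eq_abs, sq_abs]
      _ ≤ _ := h
      _ = _ := by ring
  · have him : ((u : ℂ) + Complex.I * (A / R ^ 2 : ℝ)).im = A / R ^ 2 := by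
      rw [Complex.add_im, Complex.ofReal_im, Complex.I_mul_im, Complex.ofReal_re, zero_add]
    have hτ : 0 < ((u : ℂ) + Complex.I * (A / R ^ 2 : ℝ)).im := by rw [him]; positivity
    have hlim : (-Complex.I * A / R).im = -(A / R) := by
      rw [show -Complex.I * A / R = ((-(A / R) : ℝ) : ℂ) * Complex.I by push_cast; ring]
      simp
    have hb := hC v w hv hw ⟨_, hτ⟩ (-Complex.I * A / R) (by
      rw [← UpperHalfPlane.coe_im]
      change _ ≤ A * ((u : ℂ) + Complex.I * (A / R ^ 2 : ℝ)).im
      rw [him]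
      simp [abs_of_pos hA, abs_of_pos hR]
      exact le_of_eq (by ring))
    change thetaDiffInv v w _ ((u : ℂ) + Complex.I * (A / R ^ 2 : ℝ)) ≤ C at hb
    have h1 := (hasSum_capWeight hA hR hv u).2.sub (hasSum_capWeight hA hR hw u).2
    simp only [← sub_mul, ← Complex.ofReal_sub] at h1
    rw [h1.tsum_eq, ← mul_sub, norm_mul, Complex.norm_real, Real.norm_of_nonneg (Real.exp_pos _).le]
    rw [thetaDiffInv, him, hlim, thetaDiff] at hb
    have h2 : (-(A / R)) ^ 2 / (A / R ^ 2) = A := by field_simp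
    rw [h2] at hb
    rw [div_mul_eq_mul_div, le_div_iff₀ hA]
    have hk : A / R ^ 2 * Real.exp (-Real.pi * A) *
        ‖∏ j, jacobiTheta₂ (-Complex.I * A / R * v j) (u + Complex.I * (A / R ^ 2 : ℝ)) -
          ∏ j, jacobiTheta₂ (-Complex.I * A / R * w j) (u + Complex.I * (A / R ^ 2 : ℝ))‖ ≤ C := by
      refine le_trans ?_ hb
      gcongr
      rw [add_assoc]
      exact le_add_of_nonneg_right (by positivity)
    have hR2 : 0 < R ^ 2 := by positivity
    rw [div_mul_eq_mul_div, div_mul_eq_mul_div, div_le_iff₀ hR2] at hk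
    linarith

/-- The integral quaternion with the given coordinates. -/
def intQuat (a b c d : ℤ) : Quaternion ℤ := ⟨a, b, c, d⟩

@[simp] lemma intQuat_re (a b c d : ℤ) : (intQuat a b c d).re = a := rfl
@[simp] lemma intQuat_imI (a b c d : ℤ) : (intQuat a b c d).imI = b := rfl
@[simp] lemma intQuat_imJ (a b c d : ℤ) : (intQuat a b c d).imJ = c := rfl
@[simp] lemma intQuat_imK (a b c d : ℤ) : (intQuat a b c d).imK = d := rfl

/-- The left ideal of integral quaternions annihilated modulo `p` by `1 - a i - b j`. -/
def annihilatorMod (p a b : ℤ) (x : Quaternion ℤ) : Prop :=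
  ∃ y : Quaternion ℤ, x * star (intQuat 1 a b 0) = p • y

lemma annihilatorMod.mul_left {p a b : ℤ} {x : Quaternion ℤ} (h : annihilatorMod p a b x)
    (z : Quaternion ℤ) : annihilatorMod p a b (z * x) := by
  obtain ⟨y, hy⟩ := h
  exact ⟨z * y, by rw [mul_assoc, hy, mul_smul_comm]⟩

lemma annihilatorMod.sub_smul {p a b : ℤ} {x : Quaternion ℤ} (h : annihilatorMod p a b x)
    (z : Quaternion ℤ) : annihilatorMod p a b (x - p • z) := by
  obtain ⟨y, hy⟩ := h
  exact ⟨y - z * star (intQuat 1 a b 0), by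
    rw [sub_mul, hy, smul_sub, smul_mul_assoc]⟩

lemma annihilatorMod.of_smul {p a b m : ℤ} (hm : IsCoprime m p) {x : Quaternion ℤ}
    (h : annihilatorMod p a b (m • x)) : annihilatorMod p a b x := by
  obtain ⟨y, hy⟩ := h
  obtain ⟨u, v, huv⟩ := hm
  set g := star (intQuat 1 a b 0)
  refine ⟨u • y + v • (x * g), ?_⟩
  calc x * g = (u * m + v * p) • (x * g) := by rw [huv, one_smul]
    _ = u • (m • x * g) + v • p • (x * g) := by
        rw [add_smul, mul_smul, mul_smul, smul_mul_assoc]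
    _ = p • (u • y + v • (x * g)) := by
        rw [hy, smul_add, smul_comm p u, smul_comm p v]

lemma annihilatorMod.dvd_normSq {p a b : ℤ} {x : Quaternion ℤ} (h : annihilatorMod p a b x) :
    p ∣ Quaternion.normSq x := by
  obtain ⟨y, hy⟩ := h.mul_left (star x)
  rw [Quaternion.star_mul_self] at hy
  have := congrArg QuaternionAlgebra.re hy
  simp at this
  exact ⟨_, this⟩

lemma annihilatorMod_self {p a b : ℤ} (h : p ∣ 1 + a ^ 2 + b ^ 2) :
    annihilatorMod p a b (intQuat 1 a b 0) := by
  obtain ⟨c, hc⟩ := h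
  refine ⟨intQuat c 0 0 0, ?_⟩
  apply Quaternion.ext <;>
    simp only [Quaternion.re_mul, Quaternion.imI_mul, Quaternion.imJ_mul, Quaternion.imK_mul,
      Quaternion.re_star, Quaternion.imI_star, Quaternion.imJ_star, Quaternion.imK_star,
      Quaternion.re_smul, Quaternion.imI_smul, Quaternion.imJ_smul, Quaternion.imK_smul,
      intQuat_re, intQuat_imI, intQuat_imJ, intQuat_imK, smul_eq_mul]
  · linear_combination hc
  all_goals ring

/-- Reduction of an integral quaternion modulo `m` to absolutely least residues. -/
lemma exists_smul_sub_natAbs_le {m : ℤ} (hm : 0 < m) (hodd : Odd m) (x : Quaternion ℤ) :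
    ∃ z : Quaternion ℤ, Quaternion.normSq (x - m • z) < m ^ 2 := by
  have h : ∀ n : ℤ, ∃ k : ℤ, 4 * (n - m * k) ^ 2 < m ^ 2 := by
    intro n
    refine ⟨(2 * n + m) / (2 * m), ?_⟩
    have h1 := Int.mul_ediv_add_emod (2 * n + m) (2 * m)
    have h2 := Int.emod_nonneg (2 * n + m) (show 2 * m ≠ 0 by omega)
    have h3 := Int.emod_lt_of_pos (2 * n + m) (show 0 < 2 * m by omega)
    set k := (2 * n + m) / (2 * m)
    set r := (2 * n + m) % (2 * m)
    have h4 : 2 * (n - m * k) = r - m := by linarith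
    have h5 : r ≠ 0 := by
      intro h0
      obtain ⟨c, hc⟩ := hodd
      omega
    have h6 : 0 < r := by omega
    have : 4 * (n - m * k) ^ 2 = (r - m) ^ 2 := by rw [← h4]; ring
    rw [this]
    nlinarith
  obtain ⟨k0, h0⟩ := h x.re
  obtain ⟨k1, h1⟩ := h x.imI
  obtain ⟨k2, h2⟩ := h x.imJ
  obtain ⟨k3, h3⟩ := h x.imK
  refine ⟨intQuat k0 k1 k2 k3, ?_⟩
  rw [Quaternion.normSq_def']
  simp
  linarith

lemma normSq_smul_int (m : ℤ) (x : Quaternion ℤ) :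
    Quaternion.normSq (m • x) = m ^ 2 * Quaternion.normSq x := by
  simp [Quaternion.normSq_def']
  ring

/-- A quaternion of even norm becomes divisible by `2` after a suitable multiplication. -/
lemma exists_mul_eq_two_smul {x : Quaternion ℤ} (h : Even (Quaternion.normSq x)) :
    ∃ w z : Quaternion ℤ, Quaternion.normSq w = 2 ∧ w * x = (2 : ℤ) • z := by
  rw [Quaternion.normSq_def', Int.even_add, Int.even_add, Int.even_add, Int.even_pow' two_ne_zero,
    Int.even_pow' two_ne_zero, Int.even_pow' two_ne_zero, Int.even_pow' two_ne_zero] at h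
  have key : (Even x.re ↔ Even x.imI) ∧ (Even x.imJ ↔ Even x.imK) ∨
      (Even x.re ↔ Even x.imJ) ∧ (Even x.imI ↔ Even x.imK) ∨
      (Even x.re ↔ Even x.imK) ∧ (Even x.imI ↔ Even x.imJ) := by tauto
  rcases key with ⟨h1, h2⟩ | ⟨h1, h2⟩ | ⟨h1, h2⟩
  · obtain ⟨a, ha⟩ := Int.even_sub.2 h1
    obtain ⟨b, hb⟩ := Int.even_sub.2 h2
    refine ⟨intQuat 1 1 0 0, intQuat a (a + x.imI) b (b + x.imK),
      by simp [Quaternion.normSq_def'], ?_⟩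
    apply Quaternion.ext <;>
      simp only [Quaternion.re_mul, Quaternion.imI_mul, Quaternion.imJ_mul, Quaternion.imK_mul,
        Quaternion.re_smul, Quaternion.imI_smul, Quaternion.imJ_smul, Quaternion.imK_smul,
        intQuat_re, intQuat_imI, intQuat_imJ, intQuat_imK, smul_eq_mul] <;> linarith
  · obtain ⟨a, ha⟩ := Int.even_sub.2 h1
    obtain ⟨b, hb⟩ := Int.even_sub.2 h2
    refine ⟨intQuat 1 0 1 0, intQuat a (b + x.imK) (a + x.imJ) (-b),
      by simp [Quaternion.normSq_def'], ?_⟩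
    apply Quaternion.ext <;>
      simp only [Quaternion.re_mul, Quaternion.imI_mul, Quaternion.imJ_mul, Quaternion.imK_mul,
        Quaternion.re_smul, Quaternion.imI_smul, Quaternion.imJ_smul, Quaternion.imK_smul,
        intQuat_re, intQuat_imI, intQuat_imJ, intQuat_imK, smul_eq_mul] <;> linarith
  · obtain ⟨a, ha⟩ := Int.even_sub.2 h1
    obtain ⟨b, hb⟩ := Int.even_sub.2 h2
    refine ⟨intQuat 1 0 0 1, intQuat a b (b + x.imJ) (a + x.imK),
      by simp [Quaternion.normSq_def'], ?_⟩
    apply Quaternion.ext <;>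
      simp only [Quaternion.re_mul, Quaternion.imI_mul, Quaternion.imJ_mul, Quaternion.imK_mul,
        Quaternion.re_smul, Quaternion.imI_smul, Quaternion.imJ_smul, Quaternion.imK_smul,
        intQuat_re, intQuat_imI, intQuat_imJ, intQuat_imK, smul_eq_mul] <;> linarith

/-- Descent on the multiple of `p` represented by the ideal. -/
lemma annihilatorMod_descent {p : ℕ} (hp : p.Prime) (hp2 : p ≠ 2) {a b : ℤ} (m : ℕ) :
    0 < m → m < p → (∃ x, annihilatorMod p a b x ∧ Quaternion.normSq x = m * p) →
      ∃ x, annihilatorMod p a b x ∧ Quaternion.normSq x = p := by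
  induction m using Nat.strong_induction_on with
  | _ m ih =>
    rintro hm hmp ⟨x, hx, hxn⟩
    have hcop : ∀ k : ℕ, 0 < k → k < p → IsCoprime (k : ℤ) (p : ℤ) := fun k h0 h1 =>
      Nat.isCoprime_iff_coprime.2
        (hp.coprime_iff_not_dvd.2 (Nat.not_dvd_of_pos_of_lt h0 h1)).symm
    rcases Nat.even_or_odd m with he | ho
    · obtain ⟨k, hk⟩ := he
      obtain ⟨w, z, hw, hz⟩ := exists_mul_eq_two_smul (x := x)
        (by rw [hxn, hk]; exact ⟨k * p, by push_cast; ring⟩)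
      have hzn := congrArg Quaternion.normSq hz
      rw [map_mul, normSq_smul_int, hw, hxn, hk] at hzn
      refine ih k (by omega) (by omega) (by omega) ⟨z, ?_, by push_cast at hzn; linarith⟩
      refine annihilatorMod.of_smul (m := 2) ?_ (hz ▸ hx.mul_left w)
      exact_mod_cast hcop 2 two_pos (lt_of_le_of_ne hp.two_le hp2.symm)
    · rcases Nat.lt_or_ge 1 m with h1 | h1
      swap
      · obtain rfl : m = 1 := by omega
        exact ⟨x, hx, by simpa using hxn⟩
      have hm0 : (m : ℤ) ≠ 0 := by exact_mod_cast hm.ne'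
      obtain ⟨z, hz⟩ := exists_smul_sub_natAbs_le (m := m) (by exact_mod_cast hm)
        (by exact_mod_cast ho) x
      set y := x - (m : ℤ) • z with hy
      set t := (p : ℤ) • (1 : Quaternion ℤ) - star z * x with ht
      have hxx : star x * x = ((m : ℤ) * p) • (1 : Quaternion ℤ) := by
        rw [Quaternion.star_mul_self, hxn]
        apply Quaternion.ext <;> simp
      have hyt : star y * x = (m : ℤ) • t := by
        rw [hy, ht, star_sub, sub_mul, hxx, smul_sub, ← mul_smul, star_smul, smul_mul_assoc]
        rfl
      have hn := congrArg Quaternion.normSq hyt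
      rw [map_mul, Quaternion.normSq_star, normSq_smul_int, hxn] at hn
      have hn' : Quaternion.normSq y * p = m * Quaternion.normSq t := by
        apply mul_left_cancel₀ hm0
        linear_combination hn
      have hdvd : (m : ℤ) ∣ Quaternion.normSq y :=
        (hcop m hm hmp).dvd_of_dvd_mul_right ⟨_, hn'⟩
      obtain ⟨c, hc⟩ := hdvd
      have hmpos : (0 : ℤ) < m := by exact_mod_cast hm
      have hc0 : 0 ≤ c := by
        have := Quaternion.normSq_nonneg (a := y)
        rw [hc] at this
        exact nonneg_of_mul_nonneg_right this hmpos
      have hcm : c < m := by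
        rw [hc, sq] at hz
        exact lt_of_mul_lt_mul_left hz hmpos.le
      lift c to ℕ using hc0
      have htn : Quaternion.normSq t = c * p := by
        apply mul_left_cancel₀ hm0
        rw [← hn', hc]; ring
      refine ih c (by exact_mod_cast hcm) ?_ (by
        have : c < m := by exact_mod_cast hcm
        omega) ⟨t, ?_, htn⟩
      · rcases Nat.eq_zero_or_pos c with h0 | h0
        · exfalso
          rw [h0] at hc
          have hy0 : y = 0 := Quaternion.normSq_eq_zero.1 (by simpa using hc)
          have hxz : x = (m : ℤ) • z := by rwa [hy, sub_eq_zero] at hy0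
          rw [hxz, normSq_smul_int] at hxn
          have : (m : ℤ) ∣ p := ⟨Quaternion.normSq z, by
            apply mul_left_cancel₀ hm0
            linear_combination -hxn⟩
          have h2 : m ∣ p := by exact_mod_cast this
          rcases (Nat.dvd_prime hp).1 h2 with h3 | h3 <;> omega
        · exact h0
      · exact annihilatorMod.of_smul (hcop m hm hmp) (hyt ▸ hx.mul_left (star y))

/-- The ideal of `annihilatorMod` contains an element of norm exactly `p`. -/
lemma exists_annihilatorMod_normSq_eq {p : ℕ} (hp : p.Prime) (hp2 : p ≠ 2) {a b : ℤ}
    (h : (p : ℤ) ∣ 1 + a ^ 2 + b ^ 2) :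
    ∃ x, annihilatorMod p a b x ∧ Quaternion.normSq x = p := by
  have hpos : (0 : ℤ) < p := by exact_mod_cast hp.pos
  obtain ⟨z, hz⟩ := exists_smul_sub_natAbs_le (m := p) hpos
    (by exact_mod_cast hp.odd_of_ne_two hp2) (intQuat 1 a b 0)
  set x := intQuat 1 a b 0 - (p : ℤ) • z with hx
  have hmem : annihilatorMod p a b x := (annihilatorMod_self h).sub_smul z
  obtain ⟨c, hc⟩ := hmem.dvd_normSq
  have hx0 : x ≠ 0 := by
    intro h0
    have h1 := congrArg QuaternionAlgebra.re h0
    rw [hx, Quaternion.re_sub, Quaternion.re_smul, intQuat_re, Quaternion.re_zero, smul_eq_mul,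
      sub_eq_zero] at h1
    have h2 : (p : ℤ) ∣ 1 := ⟨_, h1⟩
    exact hp.one_lt.ne' (by exact_mod_cast Int.eq_one_of_dvd_one hpos.le h2)
  have hxpos : 0 < Quaternion.normSq x :=
    lt_of_le_of_ne Quaternion.normSq_nonneg (Ne.symm (mt Quaternion.normSq_eq_zero.1 hx0))
  have hc0 : 0 < c := by
    rw [hc] at hxpos
    exact pos_of_mul_pos_right hxpos hpos.le
  have hcp : c < p := by
    rw [hc, sq] at hz
    exact lt_of_mul_lt_mul_left hz hpos.le
  lift c to ℕ using hc0.le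
  exact annihilatorMod_descent hp hp2 c (by exact_mod_cast hc0) (by exact_mod_cast hcp)
    ⟨x, hmem, by rw [hc]; ring⟩

/-- An element of norm `p` determines the parameters of the ideal modulo `p`. -/
lemma annihilatorMod_unique {p : ℕ} (hp : p.Prime) (hp2 : p ≠ 2) {a b a' b' : ℤ}
    (h : (p : ℤ) ∣ 1 + a ^ 2 + b ^ 2) (h' : (p : ℤ) ∣ 1 + a' ^ 2 + b' ^ 2) {x : Quaternion ℤ}
    (hx : annihilatorMod p a b x) (hx' : annihilatorMod p a' b' x)
    (hn : Quaternion.normSq x = p) : (p : ℤ) ∣ a' - a ∧ (p : ℤ) ∣ b' - b := by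
  have hpp : Prime (p : ℤ) := Nat.prime_iff_prime_int.1 hp
  set α := a' - a with hα
  set β := b' - b with hβ
  obtain ⟨y, hy⟩ := hx
  obtain ⟨y', hy'⟩ := hx'
  have e1 : x * star (intQuat 0 α β 0) = (p : ℤ) • (y' - y) := by
    rw [smul_sub, ← hy, ← hy', ← mul_sub, ← star_sub]
    congr 2
  have e2 : ∀ w : Quaternion ℤ, x * star (intQuat 0 α β 0) * w = (p : ℤ) • ((y' - y) * w) := by
    intro w
    rw [e1, smul_mul_assoc]
  have hsq : (p : ℤ) ∣ α ^ 2 + β ^ 2 := by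
    by_contra hcon
    have e3 := e2 (intQuat 0 α β 0)
    have e4 : x * star (intQuat 0 α β 0) * intQuat 0 α β 0 = (α ^ 2 + β ^ 2) • x := by
      apply Quaternion.ext <;>
      simp only [Quaternion.re_mul, Quaternion.imI_mul, Quaternion.imJ_mul, Quaternion.imK_mul,
        Quaternion.re_star, Quaternion.imI_star, Quaternion.imJ_star, Quaternion.imK_star,
        Quaternion.re_smul, Quaternion.imI_smul, Quaternion.imJ_smul, Quaternion.imK_smul,
        intQuat_re, intQuat_imI, intQuat_imJ, intQuat_imK, smul_eq_mul] <;> ring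
    rw [e4] at e3
    have e5 := congrArg Quaternion.normSq e3
    rw [normSq_smul_int, normSq_smul_int, hn] at e5
    have hp0 : (p : ℤ) ≠ 0 := hpp.ne_zero
    have e6 : (α ^ 2 + β ^ 2) ^ 2 = p * Quaternion.normSq ((y' - y) * intQuat 0 α β 0) := by
      apply mul_right_cancel₀ hp0
      linear_combination e5
    exact hcon (hpp.dvd_of_dvd_pow ⟨_, e6⟩)
  have htwo : (p : ℤ) ∣ 2 * (a * α + b * β) := by
    have : 2 * (a * α + b * β) = (1 + a' ^ 2 + b' ^ 2) - (1 + a ^ 2 + b ^ 2) - (α ^ 2 + β ^ 2) := by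
      rw [hα, hβ]; ring
    rw [this]
    exact dvd_sub (dvd_sub h' h) hsq
  have hlin : (p : ℤ) ∣ a * α + b * β := by
    refine (hpp.dvd_or_dvd htwo).resolve_left fun h2 => hp2 ?_
    exact (Nat.prime_dvd_prime_iff_eq hp Nat.prime_two).1 (by exact_mod_cast h2)
  have hα2 : (p : ℤ) ∣ α ^ 2 := by
    have : α ^ 2 = (1 + a ^ 2 + b ^ 2) * α ^ 2 - (a * α + b * β) * (a * α - b * β)
        - (α ^ 2 + β ^ 2) * b ^ 2 := by ring
    rw [this]
    exact dvd_sub (dvd_sub (h.mul_right _) (hlin.mul_right _)) (hsq.mul_right _)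
  exact ⟨hpp.dvd_of_dvd_pow hα2, hpp.dvd_of_dvd_pow ((dvd_add_right hα2).1 hsq)⟩

/-- The conic `1 + a² + b² = 0` over `ℤ/p` has at least `p - 3` points. -/
lemma le_card_filter_one_add_sq_add_sq (p : ℕ) [Fact p.Prime] (hp2 : p ≠ 2) :
    p ≤ (Finset.univ.filter fun c : ZMod p × ZMod p => 1 + c.1 ^ 2 + c.2 ^ 2 = 0).card + 3 := by
  classical
  obtain ⟨a, b, hab⟩ := ZMod.sq_add_sq p (-1)
  have h2 : (2 : ZMod p) ≠ 0 := by
    intro h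
    have h' : ((2 : ℕ) : ZMod p) = 0 := by exact_mod_cast h
    rw [ZMod.natCast_eq_zero_iff] at h'
    exact hp2 ((Nat.prime_dvd_prime_iff_eq (Fact.out : p.Prime) Nat.prime_two).1 h')
  set f : Polynomial (ZMod p) := (Polynomial.X ^ 2 + Polynomial.C 1) *
    (Polynomial.C b * Polynomial.X + Polynomial.C a) with hf
  have hg0 : (Polynomial.C b * Polynomial.X + Polynomial.C a : Polynomial (ZMod p)) ≠ 0 := by
    intro h
    have ha : a = 0 := by simpa using congrArg (fun q => Polynomial.coeff q 0) h
    have hb : b = 0 := by simpa using congrArg (fun q => Polynomial.coeff q 1) h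
    rw [ha, hb] at hab
    simp at hab
  have hf0 : f ≠ 0 := mul_ne_zero (Polynomial.X_pow_add_C_ne_zero two_pos 1) hg0
  have hdeg : f.natDegree ≤ 3 := by
    refine Polynomial.natDegree_mul_le.trans ?_
    rw [Polynomial.natDegree_X_pow_add_C]
    have := Polynomial.natDegree_linear_le (a := b) (b := a)
    omega
  have hroot : ∀ t, t ∉ f.roots.toFinset → t ^ 2 + 1 ≠ 0 ∧ b * t + a ≠ 0 := by
    intro t ht
    rw [Multiset.mem_toFinset, Polynomial.mem_roots hf0, Polynomial.IsRoot, hf] at ht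
    simpa [not_or] using ht
  set s : ZMod p → ZMod p := fun t => -2 * (b * t + a) / (t ^ 2 + 1) with hs
  have hcard : (Finset.univ \ f.roots.toFinset).card ≤
      (Finset.univ.filter fun c : ZMod p × ZMod p => 1 + c.1 ^ 2 + c.2 ^ 2 = 0).card := by
    refine Finset.card_le_card_of_injOn (fun t => (a + s t, b + t * s t)) ?_ ?_
    · intro t ht
      obtain ⟨h1, -⟩ := hroot t (by simpa using ht)
      have hst : s t * (t ^ 2 + 1) = -2 * (b * t + a) := by
        rw [hs]
        exact div_mul_cancel₀ _ h1
      simp only [Finset.coe_filter, Finset.mem_univ, true_and, Set.mem_ofPred_eq]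
      linear_combination hab + s t * hst
    · intro t ht t' ht' h
      obtain ⟨h1, h3⟩ := hroot t (by simpa using ht)
      simp only [Prod.mk.injEq, add_right_inj] at h
      obtain ⟨h4, h5⟩ := h
      rw [← h4] at h5
      have : s t ≠ 0 := div_ne_zero (mul_ne_zero (neg_ne_zero.2 h2) h3) h1
      exact mul_right_cancel₀ this h5
  have hle : f.roots.toFinset.card ≤ 3 :=
    (Multiset.toFinset_card_le _).trans ((Polynomial.card_roots' f).trans hdeg)
  have := Finset.card_sdiff_add_card_inter (Finset.univ : Finset (ZMod p)) f.roots.toFinset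
  rw [Finset.univ_inter, Finset.card_univ, ZMod.card] at this
  omega

/-- An odd prime `p` is a sum of four integer squares in at least `p - 3` ways. -/
lemma exists_finset_sum_sq_eq_prime {p : ℕ} (hp : p.Prime) (hp2 : p ≠ 2) :
    ∃ X : Finset (Fin 4 → ℤ), p ≤ X.card + 3 ∧ ∀ x ∈ X, ∑ j, x j ^ 2 = p := by
  classical
  have : Fact p.Prime := ⟨hp⟩
  set S := Finset.univ.filter fun c : ZMod p × ZMod p => 1 + c.1 ^ 2 + c.2 ^ 2 = 0 with hS
  have hdvd : ∀ c ∈ S, (p : ℤ) ∣ 1 + (c.1.val : ℤ) ^ 2 + (c.2.val : ℤ) ^ 2 := by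
    intro c hc
    rw [← ZMod.intCast_zmod_eq_zero_iff_dvd]
    push_cast
    rw [ZMod.natCast_zmod_val, ZMod.natCast_zmod_val]
    exact (Finset.mem_filter.1 hc).2
  have hex : ∀ c : ZMod p × ZMod p, ∃ x : Quaternion ℤ, c ∈ S →
      annihilatorMod p c.1.val c.2.val x ∧ Quaternion.normSq x = p := by
    intro c
    by_cases hc : c ∈ S
    · obtain ⟨x, hx⟩ := exists_annihilatorMod_normSq_eq hp hp2 (hdvd c hc)
      exact ⟨x, fun _ => hx⟩
    · exact ⟨0, fun h => absurd h hc⟩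
  choose x hx using hex
  set F : ZMod p × ZMod p → Fin 4 → ℤ := fun c =>
    ![(x c).re, (x c).imI, (x c).imJ, (x c).imK] with hF
  refine ⟨S.image F, ?_, ?_⟩
  · rw [Finset.card_image_of_injOn]
    · exact le_card_filter_one_add_sq_add_sq p hp2
    · intro c hc c' hc' h
      have hxx : x c = x c' := by
        apply Quaternion.ext
        · simpa [hF] using congrFun h 0
        · simpa [hF] using congrFun h 1
        · simpa [hF] using congrFun h 2
        · simpa [hF] using congrFun h 3
      obtain ⟨h1, h2⟩ := hx c hc
      obtain ⟨h1', -⟩ := hx c' hc'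
      rw [← hxx] at h1'
      obtain ⟨h3, h4⟩ := annihilatorMod_unique hp hp2 (hdvd c hc) (hdvd c' hc') h1 h1' h2
      rw [← ZMod.intCast_zmod_eq_zero_iff_dvd] at h3 h4
      push_cast at h3 h4
      rw [ZMod.natCast_zmod_val, ZMod.natCast_zmod_val, sub_eq_zero] at h3 h4
      exact Prod.ext h3.symm h4.symm
  · intro y hy
    obtain ⟨c, hc, rfl⟩ := Finset.mem_image.1 hy
    have := (hx c hc).2
    rw [Quaternion.normSq_def'] at this
    rw [Fin.sum_univ_four]
    simpa [hF] using this

/-- The integer vectors in `ℤ⁴` of squared length `n`. -/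
noncomputable def sumSqReps (n : ℕ) : Finset (Fin 4 → ℤ) :=
  (Fintype.piFinset fun _ => Finset.Icc (-n : ℤ) n).filter fun x => ∑ j, x j ^ 2 = (n : ℤ)

lemma mem_sumSqReps {n : ℕ} {x : Fin 4 → ℤ} : x ∈ sumSqReps n ↔ ∑ j, x j ^ 2 = (n : ℤ) := by
  refine ⟨fun h => (Finset.mem_filter.1 h).2, fun h => Finset.mem_filter.2 ⟨?_, h⟩⟩
  rw [Fintype.mem_piFinset]
  intro j
  have h1 : x j ^ 2 ≤ n := h ▸ Finset.single_le_sum (f := fun j => x j ^ 2)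
    (fun i _ => sq_nonneg (x i)) (Finset.mem_univ j)
  rw [Finset.mem_Icc]
  constructor <;> nlinarith [Int.le_self_sq (x j), Int.le_self_sq (-x j)]

lemma weightedCount_natCast (A R : ℝ) (v : Fin 4 → ℝ) (n : ℕ) :
    weightedCount A R v n = ∑ x ∈ sumSqReps n, capWeight A R v x := by
  rw [weightedCount, tsum_eq_sum (s := sumSqReps n)]
  · exact Finset.sum_congr rfl fun x hx => if_pos (mem_sumSqReps.1 hx)
  · intro x hx
    exact if_neg fun h => hx (mem_sumSqReps.2 h)

lemma le_card_sumSqReps {p : ℕ} (hp : p.Prime) (hp2 : p ≠ 2) : p ≤ (sumSqReps p).card + 3 := by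
  obtain ⟨X, hX, hX'⟩ := exists_finset_sum_sq_eq_prime hp hp2
  have := Finset.card_le_card fun x hx => mem_sumSqReps.2 (hX' x hx)
  omega

/-- A finite net of unit vectors. -/
lemma exists_finset_unit_net {θ : ℝ} (hθ : 0 < θ) :
    ∃ V : Finset (Fin 4 → ℝ), (∀ v ∈ V, ∑ j, v j ^ 2 = 1) ∧
      ∀ u : Fin 4 → ℝ, ∑ j, u j ^ 2 = 1 → ∃ v ∈ V, ∑ j, (u j - v j) ^ 2 < θ := by
  have hK : IsCompact {v : Fin 4 → ℝ | ∑ j, v j ^ 2 = 1} := by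
    refine Metric.isCompact_of_isClosed_isBounded (isClosed_eq (by fun_prop) (by fun_prop)) ?_
    refine (Metric.isBounded_closedBall (x := 0) (r := 1)).subset fun v hv => ?_
    rw [mem_closedBall_zero_iff, pi_norm_le_iff_of_nonneg zero_le_one]
    intro j
    have h1 : v j ^ 2 ≤ 1 := (hv : ∑ j, v j ^ 2 = 1) ▸ Finset.single_le_sum
      (f := fun j => v j ^ 2) (fun i _ => sq_nonneg (v i)) (Finset.mem_univ j)
    exact (sq_le_one_iff_abs_le_one _).1 h1
  obtain ⟨V, hV, hcov⟩ := hK.elim_nhds_subcover (fun v => {u | ∑ j, (u j - v j) ^ 2 < θ})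
    fun v _ => (isOpen_lt (by fun_prop) (by fun_prop)).mem_nhds (by simpa using hθ)
  refine ⟨V, hV, fun u hu => ?_⟩
  simpa using hcov hu

/-- A vector whose length is close to `R` is close to `R` times some element of a unit net. -/
lemma exists_net_sum_sq_sub_le {δ : ℝ} (hδ : 0 < δ) {V : Finset (Fin 4 → ℝ)}
    (hV : ∀ u : Fin 4 → ℝ, ∑ j, u j ^ 2 = 1 → ∃ v ∈ V, ∑ j, (u j - v j) ^ 2 < δ ^ 2 / 16)
    {R : ℝ} (hR : 0 < R) {x : Fin 4 → ℝ} (h1 : R ^ 2 ≤ ∑ j, x j ^ 2)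
    (h2 : ∑ j, x j ^ 2 ≤ (1 + δ / 4) * R ^ 2) :
    ∃ v ∈ V, ∑ j, (x j - R * v j) ^ 2 ≤ δ ^ 2 / 4 * R ^ 2 := by
  set s := √(∑ j, x j ^ 2) with hs
  have hs2 : s ^ 2 = ∑ j, x j ^ 2 := Real.sq_sqrt (Finset.sum_nonneg fun j _ => sq_nonneg (x j))
  have hRs : R ≤ s := Real.le_sqrt_of_sq_le h1
  have hsR : s ≤ (1 + δ / 4) * R := by
    refine Real.sqrt_le_iff.2 ⟨by positivity, h2.trans ?_⟩
    nlinarith [mul_pos (mul_pos hδ hR) hR, sq_nonneg (δ * R)]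
  have hs0 : 0 < s := hR.trans_le hRs
  obtain ⟨v, hv, hvu⟩ := hV (fun j => x j / s) (by
    simp_rw [div_pow]
    rw [← Finset.sum_div, hs2, div_self]
    rw [← hs2]
    positivity)
  refine ⟨v, hv, ?_⟩
  have h3 : ∑ j, (x j - R * (x j / s)) ^ 2 = (s - R) ^ 2 := by
    have : ∀ j, (x j - R * (x j / s)) ^ 2 = x j ^ 2 * ((s - R) / s) ^ 2 := by
      intro j
      field_simp
    simp_rw [this]
    rw [← Finset.sum_mul, ← hs2]
    field_simp
  have h4 : (s - R) ^ 2 ≤ (δ / 4 * R) ^ 2 := by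
    apply pow_le_pow_left₀ <;> linarith
  calc ∑ j, (x j - R * v j) ^ 2
      ≤ ∑ j, (2 * (x j - R * (x j / s)) ^ 2 + 2 * R ^ 2 * (x j / s - v j) ^ 2) := by
        refine Finset.sum_le_sum fun j _ => ?_
        nlinarith [sq_nonneg ((x j - R * (x j / s)) - R * (x j / s - v j))]
    _ = 2 * (s - R) ^ 2 + 2 * R ^ 2 * ∑ j, (x j / s - v j) ^ 2 := by
        rw [Finset.sum_add_distrib, ← Finset.mul_sum, ← Finset.mul_sum, h3]
    _ ≤ 2 * (δ / 4 * R) ^ 2 + 2 * R ^ 2 * (δ ^ 2 / 16) := by gcongr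
    _ = δ ^ 2 / 4 * R ^ 2 := by ring

/-- If no vector of squared length `r` lies in the cap around `v`, the weighted counts over the net
differ noticeably from the one at `v`. -/
lemma le_sum_sq_weightedCount_sub {δ A R : ℝ} (hδ : 0 < δ) (hA : 0 < A) (hR : 0 < R)
    (hR6 : 6 ≤ R ^ 2) {V : Finset (Fin 4 → ℝ)}
    (hV : ∀ u : Fin 4 → ℝ, ∑ j, u j ^ 2 = 1 → ∃ v ∈ V, ∑ j, (u j - v j) ^ 2 < δ ^ 2 / 16)
    (hVA : V.card * Real.exp (-Real.pi * A * δ ^ 2) ≤ Real.exp (-Real.pi * A * (δ ^ 2 / 4)) / 2)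
    {v : Fin 4 → ℝ} {r : ℕ} (hr : r.Prime) (hr1 : R ^ 2 ≤ r) (hr2 : r ≤ (1 + δ / 4) * R ^ 2)
    (hno : ∀ x : Fin 4 → ℤ, ∑ j, x j ^ 2 = (r : ℤ) →
      δ ^ 2 * R ^ 2 ≤ ∑ j, ((x j : ℝ) - R * v j) ^ 2) :
    (R ^ 2 * Real.exp (-Real.pi * A * (δ ^ 2 / 4)) / 4) ^ 2 ≤
      V.card * ∑ w ∈ V, (weightedCount A R w r - weightedCount A R v r) ^ 2 := by
  set E' := Real.exp (-Real.pi * A * (δ ^ 2 / 4)) with hE'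
  set E := Real.exp (-Real.pi * A * δ ^ 2) with hE
  set N : ℝ := ((sumSqReps r).card : ℝ) with hN
  have hE'0 : 0 < E' := Real.exp_pos _
  have hpi := Real.pi_pos
  have hr6 : (6 : ℝ) ≤ r := hR6.trans hr1
  have hrN : R ^ 2 / 2 ≤ N := by
    have h1 := le_card_sumSqReps hr (by rintro rfl; norm_num at hr6)
    have h2 : (r : ℝ) ≤ N + 3 := by
      rw [hN]
      exact_mod_cast h1
    linarith
  have hupper : weightedCount A R v r ≤ N * E := by
    rw [weightedCount_natCast, hN, ← nsmul_eq_mul]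
    refine Finset.sum_le_card_nsmul _ _ _ fun x hx => ?_
    have h1 := hno x (mem_sumSqReps.1 hx)
    rw [capWeight, hE, Real.exp_le_exp, div_le_iff₀ (by positivity)]
    have := mul_le_mul_of_nonneg_left h1 (mul_pos hpi hA).le
    linarith
  have hlower : N * E' ≤ ∑ w ∈ V, weightedCount A R w r := by
    simp_rw [weightedCount_natCast]
    rw [Finset.sum_comm, hN, ← nsmul_eq_mul]
    refine Finset.card_nsmul_le_sum _ _ _ fun x hx => ?_
    have hxr : ∑ j, (x j : ℝ) ^ 2 = r := by exact_mod_cast mem_sumSqReps.1 hx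
    obtain ⟨w, hw, hxw⟩ := exists_net_sum_sq_sub_le hδ hV hR (x := fun j => (x j : ℝ))
      (by rwa [hxr]) (by rwa [hxr])
    refine le_trans ?_ (Finset.single_le_sum (f := fun w => capWeight A R w x)
      (fun w _ => (Real.exp_pos _).le) hw)
    rw [capWeight, hE', Real.exp_le_exp, le_div_iff₀ (by positivity)]
    have := mul_le_mul_of_nonneg_left hxw (mul_pos hpi hA).le
    linarith
  have hdiff : R ^ 2 * E' / 4 ≤ ∑ w ∈ V, (weightedCount A R w r - weightedCount A R v r) := by
    rw [Finset.sum_sub_distrib, Finset.sum_const, nsmul_eq_mul]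
    have hN0 : 0 ≤ N := Nat.cast_nonneg _
    have h1 : V.card * weightedCount A R v r ≤ V.card * (N * E) := by gcongr
    have h2 := mul_le_mul_of_nonneg_left hVA hN0
    have h3 := mul_le_mul_of_nonneg_right hrN hE'0.le
    linarith
  calc (R ^ 2 * E' / 4) ^ 2
      ≤ (∑ w ∈ V, (weightedCount A R w r - weightedCount A R v r)) ^ 2 := by gcongr
    _ ≤ _ := sq_sum_le_card_mul_sum_sq

/-- Integer vectors of prime squared length are dense in direction and length. -/
theorem eventually_exists_prime_sum_sq_near {δ : ℝ} (hδ : 0 < δ) {v : Fin 4 → ℝ}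
    (hv : ∑ j, v j ^ 2 = 1) :
    ∀ᶠ R : ℝ in atTop, ∃ x : Fin 4 → ℤ, ∃ r : ℕ, r.Prime ∧ ∑ j, x j ^ 2 = (r : ℤ) ∧
      ∑ j, ((x j : ℝ) - R * v j) ^ 2 < δ ^ 2 * R ^ 2 := by
  obtain ⟨V, hV1, hV⟩ := exists_finset_unit_net (θ := δ ^ 2 / 16) (by positivity)
  set A : ℝ := (2 * V.card + 1) / δ ^ 2 with hA
  have hA0 : 0 < A := by positivity
  set E' := Real.exp (-Real.pi * A * (δ ^ 2 / 4)) with hE'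
  have hE'0 : 0 < E' := Real.exp_pos _
  have hVA : V.card * Real.exp (-Real.pi * A * δ ^ 2) ≤ E' / 2 := by
    have h1 : E' = Real.exp (-Real.pi * A * δ ^ 2) * Real.exp (Real.pi * 3 / 4 * (A * δ ^ 2)) := by
      rw [← Real.exp_add, hE']
      congr 1
      ring
    have h2 : A * δ ^ 2 = 2 * V.card + 1 := by
      rw [hA]
      field_simp
    have h3 := Real.add_one_le_exp (Real.pi * 3 / 4 * (A * δ ^ 2))
    have h4 : A * δ ^ 2 ≤ Real.pi * 3 / 4 * (A * δ ^ 2) :=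
      le_mul_of_one_le_left (by positivity) (by linarith [Real.pi_gt_three])
    rw [h1]
    have h5 : (2 * V.card : ℝ) ≤ Real.exp (Real.pi * 3 / 4 * (A * δ ^ 2)) := by linarith
    nlinarith [mul_le_mul_of_nonneg_left h5 (Real.exp_pos (-Real.pi * A * δ ^ 2)).le]
  obtain ⟨C, hC⟩ := exists_sum_sq_weightedCount_sub_le hA0
  obtain ⟨K, hK⟩ := exists_nat_gt (16 * (V.card : ℝ) ^ 2 * C / E' ^ 2)
  have hsq : Tendsto (fun R : ℝ => R ^ 2) atTop atTop := tendsto_pow_atTop two_ne_zero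
  filter_upwards [hsq.eventually (eventually_exists_many_primes (δ := δ / 4) (by positivity) K),
    hsq.eventually_ge_atTop 6, eventually_gt_atTop 0] with R hS hR6 hR
  obtain ⟨S, hSK, hS⟩ := hS
  by_contra! hcon
  have hmain : ∀ r ∈ S, (R ^ 2 * E' / 4) ^ 2 ≤
      V.card * ∑ w ∈ V, (weightedCount A R w r - weightedCount A R v r) ^ 2 := fun r hr =>
    le_sum_sq_weightedCount_sub hδ hA0 hR hR6 hV hVA (hS r hr).1 (hS r hr).2.1 (hS r hr).2.2
      fun x hx => hcon x r (hS r hr).1 hx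
  have hmoment : ∀ w ∈ V, ∑ r ∈ S, (weightedCount A R w r - weightedCount A R v r) ^ 2 ≤
      C * R ^ 4 := fun w hw => by
    have := hC R hR w v (hV1 w hw) hv (S.map Nat.castEmbedding)
    rwa [Finset.sum_map] at this
  have h1 : S.card * (R ^ 2 * E' / 4) ^ 2 ≤ V.card * (V.card * (C * R ^ 4)) := by
    calc S.card * (R ^ 2 * E' / 4) ^ 2
        ≤ ∑ r ∈ S, V.card * ∑ w ∈ V, (weightedCount A R w r - weightedCount A R v r) ^ 2 := by
          rw [← nsmul_eq_mul]
          exact Finset.card_nsmul_le_sum _ _ _ hmain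
      _ = V.card * ∑ w ∈ V, ∑ r ∈ S, (weightedCount A R w r - weightedCount A R v r) ^ 2 := by
          rw [← Finset.mul_sum, Finset.sum_comm]
      _ ≤ V.card * (V.card * (C * R ^ 4)) := by
          gcongr
          rw [← nsmul_eq_mul]
          exact Finset.sum_le_card_nsmul _ _ _ hmoment
  have h2 : (K : ℝ) * (R ^ 2 * E' / 4) ^ 2 ≤ S.card * (R ^ 2 * E' / 4) ^ 2 := by gcongr
  rw [div_lt_iff₀ (by positivity)] at hK
  have hR4 : 0 < R ^ 4 := by positivity
  have := mul_lt_mul_of_pos_right hK hR4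
  linarith

/-- A quaternion with integral coordinates and prime norm, close to a given large multiple of `y`. -/
lemma eventually_exists_isHurwitzPrime_near {y : Quaternion ℝ} (hy : y ≠ 0) {ε : ℝ} (hε : 0 < ε) :
    ∀ᶠ R : ℝ in atTop, ∃ p, IsHurwitzPrime p ∧ ‖R⁻¹ • p - y‖ < ε := by
  have hn : 0 < ‖y‖ := norm_pos_iff.2 hy
  have hsq : ∀ q : Quaternion ℝ, ‖q‖ ^ 2 = q.re ^ 2 + q.imI ^ 2 + q.imJ ^ 2 + q.imK ^ 2 := by
    intro q
    rw [sq, ← Quaternion.normSq_eq_norm_mul_self, Quaternion.normSq_def']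
  have hv : ∑ j, (![y.re / ‖y‖, y.imI / ‖y‖, y.imJ / ‖y‖, y.imK / ‖y‖] j) ^ 2 = 1 := by
    rw [Fin.sum_univ_four]
    simp only [Matrix.cons_val]
    simp only [div_pow]
    rw [← add_div, ← add_div, ← add_div, ← hsq, div_self (by positivity)]
  have h1 := eventually_exists_prime_sum_sq_near (δ := ε / ‖y‖) (by positivity) hv
  have h2 : Tendsto (fun R : ℝ => R * ‖y‖) atTop atTop := tendsto_id.atTop_mul_const hn
  filter_upwards [h2.eventually h1, eventually_gt_atTop 0] with R hR hR0
  obtain ⟨x, r, hr, hxr, hx⟩ := hR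
  obtain ⟨p, hp⟩ : ∃ p : Quaternion ℝ, p = ⟨(x 0 : ℝ), x 1, x 2, x 3⟩ := ⟨_, rfl⟩
  have e0 : p.re = x 0 := by rw [hp]
  have e1 : p.imI = x 1 := by rw [hp]
  have e2 : p.imJ = x 2 := by rw [hp]
  have e3 : p.imK = x 3 := by rw [hp]
  refine ⟨p, ⟨Or.inl ⟨_, _, _, _, hp⟩, r, hr, ?_⟩, ?_⟩
  · rw [qNorm, e0, e1, e2, e3]
    rw [Fin.sum_univ_four] at hxr
    exact_mod_cast hxr
  · refine lt_of_pow_lt_pow_left₀ 2 hε.le ?_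
    rw [Fin.sum_univ_four] at hx
    simp only [Matrix.cons_val] at hx
    have h3 : ∀ a b : ℝ, a - R * ‖y‖ * (b / ‖y‖) = R * (R⁻¹ * a - b) := by
      intro a b
      field_simp
    have h4 : (ε / ‖y‖) ^ 2 * (R * ‖y‖) ^ 2 = R ^ 2 * ε ^ 2 := by field_simp
    rw [h3, h3, h3, h3, h4] at hx
    rw [hsq, Quaternion.re_sub, Quaternion.imI_sub, Quaternion.imJ_sub, Quaternion.imK_sub,
      Quaternion.re_smul, Quaternion.imI_smul, Quaternion.imJ_smul, Quaternion.imK_smul,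
      e0, e1, e2, e3]
    simp only [smul_eq_mul]
    refine lt_of_mul_lt_mul_left (a := R ^ 2) ?_ (by positivity)
    linarith

theorem hurwitz_prime_quotients_dense :
    Dense {x : Quaternion ℝ | ∃ p q : Quaternion ℝ,
      IsHurwitzPrime p ∧ IsHurwitzPrime q ∧ x = p * q⁻¹} := by
  have hne : Dense ({0}ᶜ : Set (Quaternion ℝ)) := dense_compl_singleton 0
  refine Dense.of_closure (hne.mono fun y hy => ?_)
  have hcont : ContinuousAt (fun z : Quaternion ℝ × Quaternion ℝ => z.1 * z.2⁻¹) (y, 1) :=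
    continuousAt_fst.mul (continuousAt_snd.inv₀ one_ne_zero)
  rw [mem_closure_iff_nhds]
  intro t ht
  have ht' : t ∈ 𝓝 (y * 1⁻¹) := by rwa [inv_one, mul_one]
  obtain ⟨ε, hε, hball⟩ := Metric.mem_nhds_iff.1 (hcont ht')
  obtain ⟨R, ⟨p, hp, hpy⟩, ⟨q, hq, hq1⟩, hR⟩ := ((eventually_exists_isHurwitzPrime_near hy hε).and
    ((eventually_exists_isHurwitzPrime_near one_ne_zero hε).and (eventually_gt_atTop 0))).exists
  refine ⟨p * q⁻¹, ?_, p, q, hp, hq, rfl⟩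
  have hmem : (R⁻¹ • p, R⁻¹ • q) ∈ Metric.ball (y, (1 : Quaternion ℝ)) ε := by
    rw [Metric.mem_ball, Prod.dist_eq, max_lt_iff, dist_eq_norm, dist_eq_norm]
    exact ⟨hpy, hq1⟩
  have := hball hmem
  have heq : R⁻¹ • p * (R⁻¹ • q)⁻¹ = p * q⁻¹ := by
    rw [smul_inv₀, inv_inv, smul_mul_smul_comm, inv_mul_cancel₀ hR.ne', one_smul]
  rwa [Set.mem_preimage, heq] at this
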